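/- arXiv:0806.2165 — 2 statements merged into one kernel-verified Lean document; each statement's English description precedes it below -/
import Mathlib

section
/- Let G be a finite group and k a field of characteristic p dividing |G|. The Tate cohomology functor Ĥ*(G,−) is faithful on thick_G(k) if and only if every object of thick_G(k) is isomorphic in the stable module category to a finite direct sum of modules Ω^i k. -/
open CategoryTheory

namespace StmodGH

/-- The trivial `kG`-module `k`, as a module over the group algebra. -/
noncomputable def triv (k G : Type) [Field k] [Group G] : ModuleCat (MonoidAlgebra k G) :=
  ModuleCat.of _ (Representation.trivial k (G := G) (V := k)).asModule

variable {A : Type} [Ring A]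

/-- A map is zero in the stable module category iff it factors through a projective. -/
def StablyZero {M N : ModuleCat A} (f : M ⟶ N) : Prop :=
  ∃ P : ModuleCat A, Projective P ∧ ∃ (g : M ⟶ P) (h : P ⟶ N), f = g ≫ h

/-- Two modules are isomorphic in the stable module category. -/
def StablyIso (M N : ModuleCat A) : Prop :=
  ∃ (f : M ⟶ N) (g : N ⟶ M), StablyZero (f ≫ g - 𝟙 M) ∧ StablyZero (g ≫ f - 𝟙 N)

/-- A short exact sequence `0 → X → Y → Z → 0` of modules. -/
structure SES (X Y Z : ModuleCat A) where
  i : X ⟶ Y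
  p : Y ⟶ Z
  inj : Function.Injective i
  surj : Function.Surjective p
  exact : ∀ y : Y, p y = 0 ↔ ∃ x, i x = y

/-- `Ω` is a family of syzygies/cosyzygies of `M`: `Ω 0 ≃ M` stably, and each
`Ω (i+1)` is the kernel of a surjection from a (finitely generated) projective onto `Ω i`. -/
def IsSyzygyFamily (M : ModuleCat A) (Ω : ℤ → ModuleCat A) : Prop :=
  (∀ i, Module.Finite A (Ω i)) ∧ StablyIso (Ω 0) M ∧
    ∀ i : ℤ, ∃ P : ModuleCat A, Projective P ∧ Nonempty (SES (Ω (i + 1)) P (Ω i))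

/-- Indecomposability, via idempotent endomorphisms. -/
def Indecomp (M : ModuleCat A) : Prop :=
  ¬ Limits.IsZero M ∧ ∀ f : M ⟶ M, f ≫ f = f → f = 0 ∨ f = 𝟙 M

/-- Membership in the thick subcategory of the stable module category generated by `G₀`:
the smallest class containing `G₀`, containing the (stably trivial) projective modules,
closed under stable isomorphism, under exact triangles (equivalently, two-out-of-three for
short exact sequences), and under direct summands. -/
inductive InThick (G₀ : ModuleCat A) : ModuleCat A → Prop
  | gen : InThick G₀ G₀
  | proj (P : ModuleCat A) : Projective P → InThick G₀ P
  | iso {M N : ModuleCat A} : StablyIso M N → InThick G₀ M → InThick G₀ N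
  | ext₁ {X Y Z : ModuleCat A} : SES X Y Z → InThick G₀ X → InThick G₀ Y → InThick G₀ Z
  | ext₂ {X Y Z : ModuleCat A} : SES X Y Z → InThick G₀ X → InThick G₀ Z → InThick G₀ Y
  | ext₃ {X Y Z : ModuleCat A} : SES X Y Z → InThick G₀ Y → InThick G₀ Z → InThick G₀ X
  | summand {M N : ModuleCat A} : (∃ (s : M ⟶ N) (r : N ⟶ M), s ≫ r = 𝟙 M) →
      InThick G₀ N → InThick G₀ M

/-- A short exact sequence `0 → X → B → N → 0` is almost split: it is non-split, has
indecomposable end terms, and every map to `N` that is not a split epimorphism factors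
through the middle term `B`. -/
def IsAlmostSplit {X B N : ModuleCat A} (s : SES X B N) : Prop :=
  Indecomp X ∧ Indecomp N ∧ (¬ ∃ sec : N ⟶ B, sec ≫ s.p = 𝟙 N) ∧
    ∀ (M : ModuleCat A) (f : M ⟶ N),
      (¬ ∃ sec : N ⟶ M, sec ≫ f = 𝟙 N) → ∃ g : M ⟶ B, g ≫ s.p = f

/-- The generating hypothesis for `kG`: every map in the thick subcategory generated by the
trivial module which induces the zero map on Tate cohomology
`Ĥ^i(G,−) = Hom_stmod(Ω^i k, −)` is zero in the stable module category. -/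
def GHolds (k G : Type) [Field k] [Group G] [Fintype G] : Prop :=
  ∀ Ωk : ℤ → ModuleCat (MonoidAlgebra k G), IsSyzygyFamily (triv k G) Ωk →
    ∀ M N : ModuleCat (MonoidAlgebra k G), InThick (triv k G) M → InThick (triv k G) N →
      ∀ f : M ⟶ N, (∀ (i : ℤ) (g : Ωk i ⟶ M), StablyZero (g ≫ f)) → StablyZero f


set_option linter.unusedSectionVars false

section Norm

variable {k G : Type} [Field k] [Group G]
variable {X Y Z : Type}
  [AddCommGroup X] [Module k X] [Module (MonoidAlgebra k G) X] [IsScalarTower k (MonoidAlgebra k G) X]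
  [AddCommGroup Y] [Module k Y] [Module (MonoidAlgebra k G) Y] [IsScalarTower k (MonoidAlgebra k G) Y]
  [AddCommGroup Z] [Module k Z] [Module (MonoidAlgebra k G) Z] [IsScalarTower k (MonoidAlgebra k G) Z]

/-- The action of a group element on a `kG`-module, as a `k`-linear map. -/
noncomputable def translate (k : Type) {G : Type} [Field k] [Group G] (X : Type) [AddCommGroup X]
    [Module k X] [Module (MonoidAlgebra k G) X] [IsScalarTower k (MonoidAlgebra k G) X] (g : G) :
    X →ₗ[k] X :=
  MonoidAlgebra.GroupSMul.linearMap k X g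

lemma translate_apply (g : G) (x : X) :
    translate k X g x = MonoidAlgebra.single g (1 : k) • x := rfl

lemma translate_mul_apply (g h : G) (x : X) :
    translate k X (g * h) x = translate k X g (translate k X h x) := by
  simp [translate_apply, smul_smul, MonoidAlgebra.single_mul_single]

lemma translate_one_apply (x : X) : translate k X (1 : G) x = x := by
  simp [translate_apply, ← MonoidAlgebra.one_def]

lemma map_translate (f : X →ₗ[MonoidAlgebra k G] Y) (g : G) (x : X) :
    f (translate k X g x) = translate k Y g (f x) := by
  simp [translate_apply]

variable [Fintype G]

/-- The norm `∑ g, g⁻¹ d g` of a `k`-linear map. -/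
noncomputable def norm (d : X →ₗ[k] Y) : X →ₗ[MonoidAlgebra k G] Y :=
  d.sumOfConjugatesEquivariant G

lemma norm_apply (d : X →ₗ[k] Y) (x : X) :
    norm (G := G) d x = ∑ g : G, translate k Y g⁻¹ (d (translate k X g x)) := by
  simp [norm, LinearMap.sumOfConjugatesEquivariant_apply, LinearMap.conjugate_apply,
    translate_apply]

lemma norm_zero : norm (G := G) (0 : X →ₗ[k] Y) = 0 := by
  ext x; simp [norm_apply]

lemma norm_add (d e : X →ₗ[k] Y) : norm (G := G) (d + e) = norm d + norm e := by
  ext x; simp [norm_apply, Finset.sum_add_distrib]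

lemma norm_neg (d : X →ₗ[k] Y) : norm (G := G) (-d) = -norm d := by
  ext x; simp [norm_apply]

lemma norm_sub (d e : X →ₗ[k] Y) : norm (G := G) (d - e) = norm d - norm e := by
  ext x; simp [norm_apply, Finset.sum_sub_distrib]

lemma norm_smul_apply (c : k) (d : X →ₗ[k] Y) (x : X) :
    norm (G := G) (c • d) x = c • norm (G := G) d x := by
  simp [norm_apply, Finset.smul_sum]

lemma comp_norm (f : Y →ₗ[MonoidAlgebra k G] Z) (d : X →ₗ[k] Y) :
    f ∘ₗ norm d = norm (f.restrictScalars k ∘ₗ d) := by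
  ext x; simp [norm_apply, map_translate]

lemma norm_comp (d : Y →ₗ[k] Z) (f : X →ₗ[MonoidAlgebra k G] Y) :
    norm d ∘ₗ f = norm (d ∘ₗ f.restrictScalars k) := by
  ext x; simp [norm_apply, map_translate]

lemma norm_translate_comp (h : G) (d : X →ₗ[k] Y) :
    norm (G := G) (translate k Y h ∘ₗ d) = norm (d ∘ₗ translate k X h) := by
  ext x
  simp only [norm_apply, LinearMap.comp_apply]
  refine Fintype.sum_bijective (h⁻¹ * ·) (Group.mulLeft_bijective h⁻¹) _ _ fun g => ?_
  rw [← translate_mul_apply, ← translate_mul_apply]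
  simp

/-- A `k`-linear map commuting with group elements is `kG`-linear. -/
lemma exists_equivariant (d : X →ₗ[k] Y)
    (h : ∀ (g : G) (x : X), d (translate k X g x) = translate k Y g (d x)) :
    ∃ f : X →ₗ[MonoidAlgebra k G] Y, f.restrictScalars k = d :=
  ⟨MonoidAlgebra.equivariantOfLinearOfComm d h, by ext x; rfl⟩

/-- Coefficient at `g` in the induced module `kG ⊗ X`. -/
noncomputable def coeffAt (g : G) : TensorProduct k (MonoidAlgebra k G) X →ₗ[k] X :=
  TensorProduct.lift
    ((LinearMap.lsmul k X).comp
      ((Finsupp.lapply g).comp (MonoidAlgebra.coeffLinearEquiv k).toLinearMap))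

/-- The unit `X → kG ⊗ X`. -/
noncomputable def unitInd (k G : Type) [Field k] [Group G] (X : Type) [AddCommGroup X]
    [Module k X] : X →ₗ[k] TensorProduct k (MonoidAlgebra k G) X :=
  TensorProduct.mk k (MonoidAlgebra k G) X 1

/-- The `kG`-linear extension `kG ⊗ X → Y` of a `k`-linear map `X → Y`. -/
noncomputable def liftInd (d : X →ₗ[k] Y) :
    TensorProduct k (MonoidAlgebra k G) X →ₗ[MonoidAlgebra k G] Y :=
  TensorProduct.AlgebraTensorModule.lift (LinearMap.toSpanSingleton (MonoidAlgebra k G) _ d)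

lemma liftInd_tmul (d : X →ₗ[k] Y) (a : MonoidAlgebra k G) (x : X) :
    liftInd d (a ⊗ₜ[k] x) = a • d x := by
  simp [liftInd]

lemma liftInd_comp_unitInd (d : X →ₗ[k] Y) :
    (liftInd (G := G) d).restrictScalars k ∘ₗ unitInd k G X = d := by
  ext x; simp [unitInd, liftInd_tmul]

lemma liftInd_id_surjective :
    Function.Surjective (liftInd (G := G) (LinearMap.id : X →ₗ[k] X)) := fun x =>
  ⟨1 ⊗ₜ[k] x, by simp [liftInd_tmul]⟩

lemma coeffAt_tmul (g : G) (a : MonoidAlgebra k G) (x : X) :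
    coeffAt g (a ⊗ₜ[k] x) = a.coeff g • x := by
  simp [coeffAt]

lemma coeffAt_unitInd [DecidableEq G] (g : G) (x : X) :
    coeffAt g (unitInd k G X x) = if g = 1 then x else 0 := by
  simp [unitInd, coeffAt_tmul, MonoidAlgebra.one_def, Finsupp.single_apply, ite_smul, eq_comm]

lemma coeffAt_translate (g h : G) (t : TensorProduct k (MonoidAlgebra k G) X) :
    coeffAt g (translate k _ h t) = coeffAt (h⁻¹ * g) t := by
  induction t using TensorProduct.induction_on with
  | zero => simp
  | add a b ha hb => simp [ha, hb]
  | tmul a x => 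
    simp [translate_apply, TensorProduct.smul_tmul', coeffAt_tmul]

lemma liftInd_id_eq_sum (t : TensorProduct k (MonoidAlgebra k G) X) :
    liftInd LinearMap.id t = ∑ g : G, translate k X g (coeffAt g t) := by
  induction t using TensorProduct.induction_on with
  | zero => simp
  | add a b ha hb => simp [ha, hb, Finset.sum_add_distrib]
  | tmul a x =>
    induction a using MonoidAlgebra.induction_linear with
    | zero => simp
    | add a b ha hb => simp [ha, hb, TensorProduct.add_tmul, Finset.sum_add_distrib]
    | single g c =>
      classical
      simp only [liftInd_tmul, coeffAt_tmul, MonoidAlgebra.coeff_single, Finsupp.single_apply,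
        ite_smul, zero_smul, apply_ite, map_zero, Finset.sum_ite_eq, Finset.mem_univ, if_true,
        LinearMap.id_apply, map_smul, translate_apply]
      rw [← smul_assoc, MonoidAlgebra.smul_single, smul_eq_mul, mul_one]

instance : Module.Projective (MonoidAlgebra k G) (TensorProduct k (MonoidAlgebra k G) X) :=
  inferInstance

lemma norm_eq_liftInd_comp (d : X →ₗ[k] Y) :
    norm (G := G) d = liftInd d ∘ₗ norm (unitInd k G X) := by
  rw [comp_norm, liftInd_comp_unitInd]

lemma norm_unitInd_comp_coeffAt :
    norm (G := G) (unitInd k G X ∘ₗ coeffAt (1 : G)) = LinearMap.id := by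
  refine LinearMap.ext fun t => ?_
  rw [norm_apply]
  induction t using TensorProduct.induction_on with
  | zero => simp
  | add a b ha hb => simp only [map_add, Finset.sum_add_distrib, ha, hb]
  | tmul a x =>
    induction a using MonoidAlgebra.induction_linear with
    | zero => simp
    | add a b ha hb =>
      simp only [TensorProduct.add_tmul, map_add, Finset.sum_add_distrib, ha, hb]
    | single h c =>
      rw [Finset.sum_eq_single h⁻¹]
      · simp only [LinearMap.comp_apply, coeffAt_tmul, unitInd, TensorProduct.mk_apply,
          translate_apply, TensorProduct.smul_tmul', smul_eq_mul, mul_one, inv_inv,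
          MonoidAlgebra.single_mul_single, inv_mul_cancel, one_mul, MonoidAlgebra.coeff_single,
          Finsupp.single_eq_same, LinearMap.id_apply]
        rw [← TensorProduct.smul_tmul, MonoidAlgebra.smul_single, smul_eq_mul, mul_one]
      · intro g _ hg
        have hne : h ≠ g⁻¹ := fun e => hg (by rw [e, inv_inv])
        simp [coeffAt_translate, coeffAt_tmul, hne]
      · simp

/-- On a projective module the identity is a norm. -/
lemma exists_norm_eq_id [Module.Projective (MonoidAlgebra k G) X] :
    ∃ e : X →ₗ[k] X, norm (G := G) e = LinearMap.id := by
  obtain ⟨s, hs⟩ := Module.projective_lifting_property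
    (liftInd (G := G) (LinearMap.id : X →ₗ[k] X)) LinearMap.id liftInd_id_surjective
  refine ⟨(liftInd LinearMap.id).restrictScalars k ∘ₗ
    (unitInd k G X ∘ₗ coeffAt (1 : G)) ∘ₗ s.restrictScalars k, ?_⟩
  rw [← comp_norm, ← norm_comp, norm_unitInd_comp_coeffAt, LinearMap.id_comp, hs]

end Norm

section StableMaps

variable {k G : Type} [Field k] [Group G] [Fintype G]
variable {X Y Z N : Type}
  [AddCommGroup X] [Module k X] [Module (MonoidAlgebra k G) X] [IsScalarTower k (MonoidAlgebra k G) X]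
  [AddCommGroup Y] [Module k Y] [Module (MonoidAlgebra k G) Y] [IsScalarTower k (MonoidAlgebra k G) Y]
  [AddCommGroup Z] [Module k Z] [Module (MonoidAlgebra k G) Z] [IsScalarTower k (MonoidAlgebra k G) Z]
  [AddCommGroup N] [Module k N] [Module (MonoidAlgebra k G) N] [IsScalarTower k (MonoidAlgebra k G) N]

/-- A `kG`-linear map is a norm; equivalently it factors through a projective module. -/
def IsNorm (f : X →ₗ[MonoidAlgebra k G] Y) : Prop :=
  ∃ d : X →ₗ[k] Y, f = norm d

lemma isNorm_norm (d : X →ₗ[k] Y) : IsNorm (norm (G := G) d) := ⟨d, rfl⟩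

lemma IsNorm.zero : IsNorm (0 : X →ₗ[MonoidAlgebra k G] Y) := ⟨0, norm_zero.symm⟩

lemma IsNorm.add {f g : X →ₗ[MonoidAlgebra k G] Y} (hf : IsNorm f) (hg : IsNorm g) :
    IsNorm (f + g) := by
  obtain ⟨d, rfl⟩ := hf
  obtain ⟨e, rfl⟩ := hg
  exact ⟨d + e, (norm_add d e).symm⟩

lemma IsNorm.neg {f : X →ₗ[MonoidAlgebra k G] Y} (hf : IsNorm f) : IsNorm (-f) := by
  obtain ⟨d, rfl⟩ := hf
  exact ⟨-d, (norm_neg d).symm⟩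

lemma IsNorm.sub {f g : X →ₗ[MonoidAlgebra k G] Y} (hf : IsNorm f) (hg : IsNorm g) :
    IsNorm (f - g) := by
  rw [sub_eq_add_neg]
  exact hf.add hg.neg

lemma IsNorm.comp_left {g : X →ₗ[MonoidAlgebra k G] Y} (hg : IsNorm g)
    (f : Y →ₗ[MonoidAlgebra k G] Z) : IsNorm (f ∘ₗ g) := by
  obtain ⟨d, rfl⟩ := hg
  exact ⟨_, comp_norm f d⟩

lemma IsNorm.comp_right {g : Y →ₗ[MonoidAlgebra k G] Z} (hg : IsNorm g)
    (f : X →ₗ[MonoidAlgebra k G] Y) : IsNorm (g ∘ₗ f) := by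
  obtain ⟨d, rfl⟩ := hg
  exact ⟨_, norm_comp d f⟩

lemma IsNorm.sum {ι : Type} (s : Finset ι) {f : ι → X →ₗ[MonoidAlgebra k G] Y}
    (hf : ∀ i ∈ s, IsNorm (f i)) : IsNorm (∑ i ∈ s, f i) :=
  Finset.sum_induction f IsNorm (fun _ _ => IsNorm.add) IsNorm.zero hf

lemma isNorm_comp_of_projective [Module.Projective (MonoidAlgebra k G) Y]
    (f : X →ₗ[MonoidAlgebra k G] Y) (g : Y →ₗ[MonoidAlgebra k G] Z) : IsNorm (g ∘ₗ f) := by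
  obtain ⟨e, he⟩ := exists_norm_eq_id (k := k) (G := G) (X := Y)
  rw [← LinearMap.id_comp f, ← he]
  exact ((isNorm_norm e).comp_right f).comp_left g

lemma isNorm_of_projective [Module.Projective (MonoidAlgebra k G) Y]
    (f : X →ₗ[MonoidAlgebra k G] Y) : IsNorm f :=
  isNorm_comp_of_projective f LinearMap.id

lemma isNorm_of_projective_domain [Module.Projective (MonoidAlgebra k G) X]
    (f : X →ₗ[MonoidAlgebra k G] Y) : IsNorm f :=
  isNorm_comp_of_projective LinearMap.id f

section

variable {E F : Type} [AddCommGroup E] [Module k E] [AddCommGroup F] [Module k F]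
  {E' F' : Type} [AddCommGroup E'] [Module k E'] [AddCommGroup F'] [Module k F']

/-- A linear map with values in a finite-dimensional subspace. -/
def FinRank (d : E →ₗ[k] F) : Prop :=
  ∃ R : Submodule k F, FiniteDimensional k R ∧ ∀ x, d x ∈ R

lemma FinRank.zero : FinRank (0 : E →ₗ[k] F) :=
  ⟨⊥, inferInstance, fun _ => by simp⟩

lemma FinRank.add {d e : E →ₗ[k] F} (hd : FinRank d) (he : FinRank e) : FinRank (d + e) := by
  obtain ⟨R, _, hR⟩ := hd
  obtain ⟨S, _, hS⟩ := he
  exact ⟨R ⊔ S, inferInstance, fun x => Submodule.add_mem_sup (hR x) (hS x)⟩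

lemma FinRank.comp_left {d : E →ₗ[k] F} (hd : FinRank d) (e : F →ₗ[k] F') :
    FinRank (e ∘ₗ d) := by
  obtain ⟨R, _, hR⟩ := hd
  exact ⟨R.map e, inferInstance, fun x => Submodule.mem_map_of_mem (hR x)⟩

lemma FinRank.comp_right {d : E →ₗ[k] F} (hd : FinRank d) (e : E' →ₗ[k] E) :
    FinRank (d ∘ₗ e) := by
  obtain ⟨R, _, hR⟩ := hd
  exact ⟨R, inferInstance, fun x => hR _⟩

lemma FinRank.sum {ι : Type} (s : Finset ι) {f : ι → E →ₗ[k] F}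
    (hf : ∀ i ∈ s, FinRank (f i)) : FinRank (∑ i ∈ s, f i) :=
  Finset.sum_induction f FinRank (fun _ _ => FinRank.add) FinRank.zero hf

lemma FinRank.of_comp_surjective {d : E →ₗ[k] F} {p : E' →ₗ[k] E} (h : FinRank (d ∘ₗ p))
    (hp : Function.Surjective p) : FinRank d := by
  obtain ⟨R, _, hR⟩ := h
  refine ⟨R, inferInstance, fun x => ?_⟩
  obtain ⟨y, rfl⟩ := hp x
  exact hR y

lemma exists_extend_of_injective (i : E →ₗ[k] E') (hi : Function.Injective i) (d : E →ₗ[k] F) :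
    ∃ d' : E' →ₗ[k] F, d' ∘ₗ i = d := by
  obtain ⟨r, hr⟩ := i.exists_leftInverse_of_injective (LinearMap.ker_eq_bot.2 hi)
  exact ⟨d ∘ₗ r, by rw [LinearMap.comp_assoc, hr, LinearMap.comp_id]⟩

lemma FinRank.exists_extend {d : E →ₗ[k] F} (hd : FinRank d) (i : E →ₗ[k] E')
    (hi : Function.Injective i) : ∃ d' : E' →ₗ[k] F, FinRank d' ∧ d' ∘ₗ i = d := by
  obtain ⟨r, hr⟩ := i.exists_leftInverse_of_injective (LinearMap.ker_eq_bot.2 hi)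
  exact ⟨d ∘ₗ r, hd.comp_right r, by rw [LinearMap.comp_assoc, hr, LinearMap.comp_id]⟩

lemma exists_section (p : F →ₗ[k] F') (hp : Function.Surjective p) :
    ∃ s : F' →ₗ[k] F, ∀ y, p (s y) = y := by
  obtain ⟨s, hs⟩ := p.exists_rightInverse_of_surjective (LinearMap.range_eq_top.2 hp)
  exact ⟨s, LinearMap.congr_fun hs⟩

lemma FinRank.of_quotient (p : F →ₗ[k] F') (hp : Function.Surjective p)
    (hker : FiniteDimensional k (LinearMap.ker p)) {d : E →ₗ[k] F} (h : FinRank (p ∘ₗ d)) :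
    FinRank d := by
  obtain ⟨s, hs⟩ := exists_section p hp
  have h1 : FinRank (d - s ∘ₗ p ∘ₗ d) :=
    ⟨LinearMap.ker p, hker, fun x => by simp [hs]⟩
  simpa using h1.add (h.comp_left s)

end

lemma FinRank.norm {d : X →ₗ[k] Y} (hd : FinRank d) :
    FinRank ((norm (G := G) d).restrictScalars k) := by
  have : (StmodGH.norm (G := G) d).restrictScalars k =
      ∑ g : G, translate k Y g⁻¹ ∘ₗ d ∘ₗ translate k X g := by
    ext x; simp [norm_apply]
  rw [this]
  exact FinRank.sum _ fun g _ => (hd.comp_right _).comp_left _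

/-- A finite-dimensional subspace lies in a finite-dimensional `kG`-submodule. -/
lemma exists_finite_submodule (R : Submodule k Y) [FiniteDimensional k R] :
    ∃ S : Submodule (MonoidAlgebra k G) Y, FiniteDimensional k S ∧ ∀ y ∈ R, y ∈ S := by
  obtain ⟨t, ht⟩ := (Module.Finite.iff_fg (N := R)).1 inferInstance
  refine ⟨Submodule.span (MonoidAlgebra k G) (t : Set Y), ?_, fun y hy => ?_⟩
  · have : Module.Finite (MonoidAlgebra k G)
      (Submodule.span (MonoidAlgebra k G) (t : Set Y)) := Module.Finite.span_finset _ t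
    exact Module.Finite.trans (MonoidAlgebra k G) _
  · rw [← ht] at hy
    exact Submodule.span_le_restrictScalars k (MonoidAlgebra k G) (t : Set Y) hy

lemma FinRank.exists_submodule {f : X →ₗ[k] Y} (hf : FinRank f) :
    ∃ S : Submodule (MonoidAlgebra k G) Y, FiniteDimensional k S ∧ ∀ x, f x ∈ S := by
  obtain ⟨R, _, hR⟩ := hf
  obtain ⟨S, hS, h⟩ := exists_finite_submodule (G := G) R
  exact ⟨S, hS, fun x => h _ (hR x)⟩

lemma IsNorm.exists_extend {f : X →ₗ[MonoidAlgebra k G] N} (hf : IsNorm f)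
    (i : X →ₗ[MonoidAlgebra k G] Y) (hi : Function.Injective i) :
    ∃ f' : Y →ₗ[MonoidAlgebra k G] N, IsNorm f' ∧ f' ∘ₗ i = f := by
  obtain ⟨d, rfl⟩ := hf
  obtain ⟨d', rfl⟩ := exists_extend_of_injective (i.restrictScalars k) hi d
  exact ⟨norm d', isNorm_norm d', norm_comp d' i⟩

lemma IsNorm.exists_lift {f : X →ₗ[MonoidAlgebra k G] Z} (hf : IsNorm f)
    (p : Y →ₗ[MonoidAlgebra k G] Z) (hp : Function.Surjective p) :
    ∃ f' : X →ₗ[MonoidAlgebra k G] Y, IsNorm f' ∧ p ∘ₗ f' = f := by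
  obtain ⟨d, rfl⟩ := hf
  obtain ⟨s, hs⟩ := exists_section (p.restrictScalars k) hp
  refine ⟨norm (s ∘ₗ d), isNorm_norm _, ?_⟩
  rw [comp_norm]
  congr 1
  ext x
  exact hs (d x)

/-- A map vanishing on the kernel of a surjection factors through it. -/
lemma exists_descend {A X Y Z N : Type} [Ring A] [AddCommGroup X] [AddCommGroup Y]
    [AddCommGroup Z] [AddCommGroup N] [Module A X] [Module A Y] [Module A Z] [Module A N]
    {i : X →ₗ[A] Y} {p : Y →ₗ[A] Z} (hp : Function.Surjective p)
    (hex : ∀ y, p y = 0 ↔ ∃ x, i x = y) (f : Y →ₗ[A] N) (hf : f ∘ₗ i = 0) :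
    ∃ h : Z →ₗ[A] N, h ∘ₗ p = f := by
  have hker : LinearMap.ker p ≤ LinearMap.ker f := fun y hy => by
    obtain ⟨x, rfl⟩ := (hex y).1 hy
    exact LinearMap.congr_fun hf x
  refine ⟨(LinearMap.ker p).liftQ f hker ∘ₗ
    (p.quotKerEquivOfSurjective hp).symm.toLinearMap, ?_⟩
  ext y
  have : (p.quotKerEquivOfSurjective hp).symm (p y) = (LinearMap.ker p).mkQ y := by
    rw [LinearEquiv.symm_apply_eq]
    rfl
  simp [this]

/-- A map into the middle term killed by the projection factors through the kernel. -/
lemma exists_factor_kernel {A X Y Z N : Type} [Ring A] [AddCommGroup X] [AddCommGroup Y]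
    [AddCommGroup Z] [AddCommGroup N] [Module A X] [Module A Y] [Module A Z] [Module A N]
    {i : X →ₗ[A] Y} {p : Y →ₗ[A] Z} (hi : Function.Injective i)
    (hex : ∀ y, p y = 0 ↔ ∃ x, i x = y) (f : N →ₗ[A] Y) (hf : p ∘ₗ f = 0) :
    ∃ h : N →ₗ[A] X, i ∘ₗ h = f := by
  have hr : ∀ n, f n ∈ LinearMap.range i := fun n => (hex _).1 (LinearMap.congr_fun hf n)
  refine ⟨(LinearEquiv.ofInjective i hi).symm.toLinearMap ∘ₗ f.codRestrict _ hr, ?_⟩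
  ext n
  have := (LinearEquiv.ofInjective i hi).apply_symm_apply (f.codRestrict _ hr n)
  exact congrArg Subtype.val this

end StableMaps

section FiniteApproximation

variable {k G : Type} [Field k] [Group G] [Fintype G]

variable (k G) in
/-- Every map out of `M` agrees stably with one of finite rank. -/
def FinApprox (M : Type) [AddCommGroup M] [Module k M] [Module (MonoidAlgebra k G) M]
    [IsScalarTower k (MonoidAlgebra k G) M] : Prop :=
  ∀ (N : Type) [AddCommGroup N] [Module k N] [Module (MonoidAlgebra k G) N]
    [IsScalarTower k (MonoidAlgebra k G) N] (f : M →ₗ[MonoidAlgebra k G] N),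
    ∃ g : M →ₗ[MonoidAlgebra k G] N, FinRank (g.restrictScalars k) ∧ IsNorm (f - g)

variable {X Y Z : Type}
  [AddCommGroup X] [Module k X] [Module (MonoidAlgebra k G) X] [IsScalarTower k (MonoidAlgebra k G) X]
  [AddCommGroup Y] [Module k Y] [Module (MonoidAlgebra k G) Y] [IsScalarTower k (MonoidAlgebra k G) Y]
  [AddCommGroup Z] [Module k Z] [Module (MonoidAlgebra k G) Z] [IsScalarTower k (MonoidAlgebra k G) Z]

lemma finApprox_of_finite [FiniteDimensional k X] : FinApprox k G X := by
  intro N _ _ _ _ f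
  exact ⟨f, ⟨LinearMap.range (f.restrictScalars k), inferInstance, fun x => ⟨x, rfl⟩⟩,
    by simpa using IsNorm.zero⟩

lemma finApprox_of_projective [Module.Projective (MonoidAlgebra k G) X] : FinApprox k G X := by
  intro N _ _ _ _ f
  exact ⟨0, FinRank.zero, by simpa using isNorm_of_projective_domain f⟩

/-- Stable retracts inherit finite approximation. -/
lemma FinApprox.of_retract (h : FinApprox k G Y) (s : X →ₗ[MonoidAlgebra k G] Y)
    (r : Y →ₗ[MonoidAlgebra k G] X) (hrs : IsNorm (r ∘ₗ s - LinearMap.id)) :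
    FinApprox k G X := by
  intro N _ _ _ _ f
  obtain ⟨g, hg, hn⟩ := h N (f ∘ₗ r)
  refine ⟨g ∘ₗ s, hg.comp_right (s.restrictScalars k), ?_⟩
  have h1 := hn.comp_right s
  have h2 := hrs.comp_left f
  convert h1.sub h2 using 1
  ext x
  simp

variable {i : X →ₗ[MonoidAlgebra k G] Y} {p : Y →ₗ[MonoidAlgebra k G] Z}

lemma FinApprox.middle (hi : Function.Injective i) (hp : Function.Surjective p)
    (hex : ∀ y, p y = 0 ↔ ∃ x, i x = y) (hX : FinApprox k G X) (hZ : FinApprox k G Z) :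
    FinApprox k G Y := by
  intro N _ _ _ _ f
  obtain ⟨g₁, hg₁, hn₁⟩ := hX N (f ∘ₗ i)
  obtain ⟨s, hs, hsi⟩ := hn₁.exists_extend i hi
  obtain ⟨R, hR, hRm⟩ := hg₁.exists_submodule (G := G)
  obtain ⟨h, hh⟩ := exists_descend hp hex (R.mkQ ∘ₗ (f - s)) (by
    ext x
    have := LinearMap.congr_fun hsi x
    simp only [LinearMap.comp_apply, LinearMap.sub_apply] at this
    simpa [this] using hRm x)
  obtain ⟨g₂, hg₂, hn₂⟩ := hZ _ h
  obtain ⟨t, ht, htR⟩ := hn₂.exists_lift R.mkQ R.mkQ_surjective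
  refine ⟨f - s - t ∘ₗ p, ?_, ?_⟩
  · refine FinRank.of_quotient (R.mkQ.restrictScalars k) R.mkQ_surjective ?_ ?_
    · have h1 : LinearMap.ker (R.mkQ.restrictScalars k) = R.restrictScalars k := by
        ext; simp
      rw [h1]
      exact hR
    · convert hg₂.comp_right (p.restrictScalars k) using 1
      ext y
      have h1 := LinearMap.congr_fun hh y
      have h2 := LinearMap.congr_fun htR (p y)
      simp only [LinearMap.comp_apply, LinearMap.sub_apply, LinearMap.restrictScalars_apply,
        map_sub] at h1 h2 ⊢
      rw [h2, ← h1]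
      abel
  · convert hs.add (ht.comp_right p) using 1
    abel

lemma FinApprox.right (hi : Function.Injective i) (hp : Function.Surjective p)
    (hex : ∀ y, p y = 0 ↔ ∃ x, i x = y) (hX : FinApprox k G X) (hY : FinApprox k G Y) :
    FinApprox k G Z := by
  intro N _ _ _ _ f
  obtain ⟨g₁, hg₁, hn₁⟩ := hY N (f ∘ₗ p)
  obtain ⟨R, hR, hRm⟩ := hg₁.exists_submodule (G := G)
  let ε : TensorProduct k (MonoidAlgebra k G) N →ₗ[MonoidAlgebra k G] N := liftInd LinearMap.id
  obtain ⟨s, -, hs⟩ := hn₁.exists_lift ε liftInd_id_surjective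
  have hs' : ∀ y, ε (s y) = f (p y) - g₁ y := LinearMap.congr_fun hs
  have hpi : ∀ x, p (i x) = 0 := fun x => (hex _).2 ⟨x, rfl⟩
  obtain ⟨g₂, hg₂, hn₂⟩ := hX (R.comap ε) ((s ∘ₗ i).codRestrict (R.comap ε) fun x => by
    simpa [hs', hpi] using hRm (i x))
  obtain ⟨s₂, -, hs₂i⟩ := hn₂.exists_extend i hi
  have hs₂ : ∀ x, ((s₂ (i x) : R.comap ε) : TensorProduct k (MonoidAlgebra k G) N) =
      s (i x) - g₂ x := fun x => congrArg Subtype.val (LinearMap.congr_fun hs₂i x)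
  obtain ⟨e, he⟩ := exists_norm_eq_id (k := k) (G := G) (X := TensorProduct k (MonoidAlgebra k G) N)
  obtain ⟨d, hd, hdi⟩ := ((hg₂.comp_left ((R.comap ε).subtype.restrictScalars k)).comp_left
    e).exists_extend (i.restrictScalars k) hi
  have hni : ∀ x, norm (G := G) d (i x) = g₂ x := fun x => by
    have h1 : norm d ∘ₗ i = norm (e ∘ₗ ((R.comap ε).subtype ∘ₗ g₂).restrictScalars k) := by
      rw [norm_comp, hdi]; rfl
    rw [← norm_comp, he, LinearMap.id_comp] at h1
    exact LinearMap.congr_fun h1 x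
  obtain ⟨t, ht⟩ := exists_descend hp hex (s - (R.comap ε).subtype ∘ₗ s₂ - norm d) (by
    ext x
    simp [hs₂, hni])
  refine ⟨f - ε ∘ₗ t, FinRank.of_comp_surjective (p := p.restrictScalars k) ?_ hp, ?_⟩
  · have h2 : FinRank (((ε ∘ₗ (R.comap ε).subtype ∘ₗ s₂).restrictScalars k)) :=
      ⟨R.restrictScalars k, hR, fun y => (s₂ y).2⟩
    convert (hg₁.add h2).add (hd.norm.comp_left (ε.restrictScalars k)) using 1
    ext y
    have h1 := LinearMap.congr_fun ht y
    simp only [LinearMap.comp_apply, LinearMap.sub_apply] at h1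
    simp only [LinearMap.comp_apply, LinearMap.sub_apply, LinearMap.restrictScalars_apply,
      LinearMap.add_apply, h1, map_sub, hs']
    abel
  · rw [sub_sub_cancel]
    exact isNorm_comp_of_projective t ε

lemma exists_embedding_projective (N : Type) [AddCommGroup N] [Module k N]
    [Module (MonoidAlgebra k G) N] [IsScalarTower k (MonoidAlgebra k G) N] :
    Function.Injective (norm (G := G) (unitInd k G N)) := by
  classical
  intro x y hxy
  have := congrArg (coeffAt (1 : G)) hxy
  simpa [norm_apply, map_sum, coeffAt_translate, coeffAt_unitInd, translate_one_apply] using this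

lemma finiteDimensional_comap_of_injective {E F : Type} [AddCommGroup E] [Module k E]
    [AddCommGroup F] [Module k F] (j : E →ₗ[k] F) (hj : Function.Injective j)
    (S : Submodule k F) (hS : FiniteDimensional k S) : FiniteDimensional k (S.comap j) :=
  Module.Finite.of_injective
    (j.restrict (p := S.comap j) (q := S) fun _ hx => hx)
    fun _ _ hab => Subtype.ext (hj (congrArg Subtype.val hab))

lemma FinApprox.left (hi : Function.Injective i) (hp : Function.Surjective p)
    (hex : ∀ y, p y = 0 ↔ ∃ x, i x = y) (hY : FinApprox k G Y) (hZ : FinApprox k G Z) :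
    FinApprox k G X := by
  intro N _ _ _ _ f
  let j : N →ₗ[MonoidAlgebra k G] TensorProduct k (MonoidAlgebra k G) N := norm (unitInd k G N)
  have hj : Function.Injective j := exists_embedding_projective N
  have hpi : ∀ x, p (i x) = 0 := fun x => (hex _).2 ⟨x, rfl⟩
  obtain ⟨F, -, hFi⟩ := (isNorm_of_projective (j ∘ₗ f)).exists_extend i hi
  obtain ⟨h, hh⟩ := exists_descend hp hex ((LinearMap.range j).mkQ ∘ₗ F) (by
    rw [LinearMap.comp_assoc, hFi]
    ext x
    simp)
  obtain ⟨g₁, hg₁, hn₁⟩ := hZ _ h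
  obtain ⟨t, -, ht⟩ := hn₁.exists_lift _ (LinearMap.range j).mkQ_surjective
  obtain ⟨σ, hσ⟩ := exists_section ((LinearMap.range j).mkQ.restrictScalars k)
    (LinearMap.range j).mkQ_surjective
  obtain ⟨V, hV, hVm⟩ := (hg₁.comp_left σ).exists_submodule (G := G)
  have hF₁ : ∀ y, (F - t ∘ₗ p) y ∈ LinearMap.range j ⊔ V := fun y => by
    have h1 := LinearMap.congr_fun hh y
    have h2 := LinearMap.congr_fun ht (p y)
    have h3 := hσ (g₁ (p y))
    have h4 : (F - t ∘ₗ p) y - σ (g₁ (p y)) ∈ LinearMap.range j := by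
      rw [← Submodule.Quotient.mk_eq_zero, ← Submodule.mkQ_apply, map_sub]
      simp only [LinearMap.comp_apply, LinearMap.sub_apply, LinearMap.restrictScalars_apply,
        map_sub] at h1 h2 h3 ⊢
      rw [h3, h2, ← h1]
      abel
    have := Submodule.add_mem_sup h4 (hVm (p y))
    simpa using this
  obtain ⟨g₂, hg₂, hn₂⟩ := hY ↥(LinearMap.range j ⊔ V) ((F - t ∘ₗ p).codRestrict _ hF₁)
  obtain ⟨W, hW, hWm⟩ := (hg₂.comp_left
    ((LinearMap.range j ⊔ V).subtype.restrictScalars k)).exists_submodule (G := G)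
  have hVW : FiniteDimensional k (V ⊔ W : Submodule (MonoidAlgebra k G) _) := by
    have h1 : Module.Finite (MonoidAlgebra k G) V := Module.Finite.of_restrictScalars_finite k _ _
    have h2 : Module.Finite (MonoidAlgebra k G) W := Module.Finite.of_restrictScalars_finite k _ _
    exact Module.Finite.trans (MonoidAlgebra k G) _
  let ψ : N →ₗ[MonoidAlgebra k G] _ := (V ⊔ W).mkQ ∘ₗ j
  have hq : ∀ n : (LinearMap.range j ⊔ V : Submodule (MonoidAlgebra k G) _),
      ((V ⊔ W).mkQ ∘ₗ (LinearMap.range j ⊔ V).subtype) n ∈ LinearMap.range ψ := by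
    rintro ⟨n, hn⟩
    obtain ⟨_, ⟨m, rfl⟩, v, hv, rfl⟩ := Submodule.mem_sup.1 hn
    refine ⟨m, ?_⟩
    have : (V ⊔ W).mkQ v = 0 := by
      simpa using Submodule.mem_sup_left hv
    simp only [ψ, LinearMap.comp_apply, Submodule.subtype_apply, map_add, this, add_zero]
  let q := LinearMap.codRestrict (LinearMap.range ψ) _ hq
  obtain ⟨t', ht', hψ⟩ := ((hn₂.comp_right i).comp_left q).exists_lift ψ.rangeRestrict
    ψ.surjective_rangeRestrict
  refine ⟨f - t', ?_, by simpa using ht'⟩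
  refine ⟨((V ⊔ W).comap j).restrictScalars k, ?_, fun x => ?_⟩
  · exact finiteDimensional_comap_of_injective (j.restrictScalars k) hj
      ((V ⊔ W).restrictScalars k) hVW
  · have h1 : ψ (t' x) = (V ⊔ W).mkQ ((F - t ∘ₗ p) (i x) - g₂ (i x)) :=
      congrArg Subtype.val (LinearMap.congr_fun hψ x)
    have h2 : (V ⊔ W).mkQ (g₂ (i x) : TensorProduct k (MonoidAlgebra k G) N) = 0 := by
      simpa using Submodule.mem_sup_right (hWm (i x))
    have h3 : F (i x) = j (f x) := LinearMap.congr_fun hFi x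
    rw [map_sub, h2, sub_zero, LinearMap.sub_apply, LinearMap.comp_apply, LinearMap.comp_apply, hpi, map_zero,
      sub_zero, h3] at h1
    change j (f x - t' x) ∈ V ⊔ W
    rw [← Submodule.Quotient.mk_eq_zero, ← Submodule.mkQ_apply, map_sub, map_sub, ← h1]
    exact sub_self _

lemma FinApprox.exists_retract (h : FinApprox k G X) :
    ∃ (F : Submodule (MonoidAlgebra k G) X) (a : X →ₗ[MonoidAlgebra k G] F),
      FiniteDimensional k F ∧ IsNorm (F.subtype ∘ₗ a - LinearMap.id) := by
  obtain ⟨g, hg, hn⟩ := h X LinearMap.id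
  obtain ⟨F, hF, hFm⟩ := hg.exists_submodule (G := G)
  have hgF : ∀ x, g x ∈ F := hFm
  refine ⟨F, g.codRestrict F hgF, hF, ?_⟩
  rw [LinearMap.subtype_comp_codRestrict, ← neg_sub]
  exact hn.neg

end FiniteApproximation

section Duality

variable {k : Type} [Field k] {E F : Type} [AddCommGroup E] [Module k E] [FiniteDimensional k E]
  [AddCommGroup F] [Module k F] [FiniteDimensional k F]

lemma eq_zero_of_trace_comp (e : F →ₗ[k] E)
    (h : ∀ d : E →ₗ[k] F, LinearMap.trace k E (e ∘ₗ d) = 0) : e = 0 := by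
  ext y
  rw [LinearMap.zero_apply, ← Module.forall_dual_apply_eq_zero_iff k]
  intro ξ
  have h1 := h (ξ.smulRight y)
  have h2 : e ∘ₗ ξ.smulRight y = ξ.smulRight (e y) := by ext; simp
  rwa [h2, LinearMap.trace_smulRight] at h1

/-- The trace pairing represents every functional on a space of linear maps. -/
lemma exists_trace_rep (ψ : (E →ₗ[k] F) →ₗ[k] k) :
    ∃ e : F →ₗ[k] E, ∀ d, ψ d = LinearMap.trace k E (e ∘ₗ d) := by
  let T : (F →ₗ[k] E) →ₗ[k] Module.Dual k (E →ₗ[k] F) :=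
    (LinearMap.compr₂ (LinearMap.llcomp k E F E) (LinearMap.trace k E))
  have hT : ∀ e d, T e d = LinearMap.trace k E (e ∘ₗ d) := fun _ _ => rfl
  have hinj : Function.Injective T := by
    rw [injective_iff_map_eq_zero]
    intro e he
    exact eq_zero_of_trace_comp e fun d => by rw [← hT, he]; rfl
  have hrank : Module.finrank k (F →ₗ[k] E) = Module.finrank k (Module.Dual k (E →ₗ[k] F)) := by
    rw [Subspace.dual_finrank_eq, Module.finrank_linearMap, Module.finrank_linearMap, mul_comm]
  obtain ⟨e, he⟩ := (LinearMap.injective_iff_surjective_of_finrank_eq_finrank hrank).1 hinj ψ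
  exact ⟨e, fun d => by rw [← hT, he]⟩

variable {G : Type} [Group G] [Fintype G]
variable {X Y Z : Type}
  [AddCommGroup X] [Module k X] [Module (MonoidAlgebra k G) X] [IsScalarTower k (MonoidAlgebra k G) X]
  [AddCommGroup Y] [Module k Y] [Module (MonoidAlgebra k G) Y] [IsScalarTower k (MonoidAlgebra k G) Y]
  [AddCommGroup Z] [Module k Z] [Module (MonoidAlgebra k G) Z] [IsScalarTower k (MonoidAlgebra k G) Z]

variable (k G X Y) in
/-- The augmentation submodule of `Hom_k(X, Y)`, spanned by the commutators with group elements. -/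
def augHom : Submodule k (X →ₗ[k] Y) :=
  Submodule.span k {c | ∃ (g : G) (d : X →ₗ[k] Y), c = d ∘ₗ translate k X g - translate k Y g ∘ₗ d}

lemma commutator_mem_augHom (g : G) (d : X →ₗ[k] Y) :
    d ∘ₗ translate k X g - translate k Y g ∘ₗ d ∈ augHom k G X Y :=
  Submodule.subset_span ⟨g, d, rfl⟩

lemma comp_mem_augHom (f : Y →ₗ[MonoidAlgebra k G] Z) {c : X →ₗ[k] Y}
    (hc : c ∈ augHom k G X Y) : f.restrictScalars k ∘ₗ c ∈ augHom k G X Z := by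
  induction hc using Submodule.span_induction with
  | mem c hc =>
    obtain ⟨g, d, rfl⟩ := hc
    convert commutator_mem_augHom g (f.restrictScalars k ∘ₗ d) using 1
    ext x
    simp [map_translate]
  | zero => simp
  | add a b _ _ ha hb => rw [LinearMap.comp_add]; exact add_mem ha hb
  | smul t a _ ha => rw [LinearMap.comp_smul]; exact Submodule.smul_mem _ _ ha

lemma mem_augHom_comp (f : X →ₗ[MonoidAlgebra k G] Y) {c : Y →ₗ[k] Z}
    (hc : c ∈ augHom k G Y Z) : c ∘ₗ f.restrictScalars k ∈ augHom k G X Z := by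
  induction hc using Submodule.span_induction with
  | mem c hc =>
    obtain ⟨g, d, rfl⟩ := hc
    convert commutator_mem_augHom g (d ∘ₗ f.restrictScalars k) using 1
    ext x
    simp [map_translate]
  | zero => simp
  | add a b _ _ ha hb => rw [LinearMap.add_comp]; exact add_mem ha hb
  | smul t a _ ha => rw [LinearMap.smul_comp]; exact Submodule.smul_mem _ _ ha

lemma trace_eq_zero_of_mem_augHom [FiniteDimensional k X] {c : X →ₗ[k] X}
    (hc : c ∈ augHom k G X X) : LinearMap.trace k X c = 0 := by
  induction hc using Submodule.span_induction with
  | mem c hc =>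
    obtain ⟨g, d, rfl⟩ := hc
    rw [map_sub, LinearMap.trace_comp_comm', sub_self]
  | zero => simp
  | add a b _ _ ha hb => rw [map_add, ha, hb, add_zero]
  | smul t a _ ha => rw [map_smul, ha, smul_zero]

/-- A map orthogonal to all equivariant maps lies in the augmentation submodule. -/
lemma mem_augHom_of_trace [FiniteDimensional k X] [FiniteDimensional k Y] (c : X →ₗ[k] Y)
    (h : ∀ e : Y →ₗ[MonoidAlgebra k G] X,
      LinearMap.trace k X (e.restrictScalars k ∘ₗ c) = 0) : c ∈ augHom k G X Y := by
  by_contra hc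
  obtain ⟨ψ, hψc, hψ⟩ := Submodule.exists_le_ker_of_notMem hc
  obtain ⟨e, he⟩ := exists_trace_rep ψ
  have hcomm : ∀ g : G, translate k X g ∘ₗ e = e ∘ₗ translate k Y g := fun g => by
    rw [← sub_eq_zero]
    refine eq_zero_of_trace_comp _ fun d => ?_
    have h1 := hψ (commutator_mem_augHom g d)
    rw [LinearMap.mem_ker, he, LinearMap.comp_sub, map_sub, ← LinearMap.comp_assoc,
      LinearMap.trace_comp_comm', ← LinearMap.comp_assoc] at h1
    rw [LinearMap.sub_comp, map_sub, ← LinearMap.comp_assoc] at *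
    exact h1
  obtain ⟨e', rfl⟩ := exists_equivariant e fun g x =>
    (LinearMap.congr_fun (hcomm g) x).symm
  exact hψc (by rw [he, h e'])

variable (k G Y) in
/-- The kernel of `kG ⊗ Y → Y`, a first syzygy of `Y`. -/
noncomputable abbrev syzygy : Submodule (MonoidAlgebra k G) (TensorProduct k (MonoidAlgebra k G) Y) :=
  LinearMap.ker (liftInd LinearMap.id)

/-- A `k`-linear map of norm zero gives a map to the first syzygy. -/
noncomputable def toSyzygy (c : X →ₗ[k] Y) (hc : norm (G := G) c = 0) :
    X →ₗ[MonoidAlgebra k G] syzygy k G Y :=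
  (norm (G := G) (unitInd k G Y ∘ₗ c)).codRestrict (syzygy k G Y) fun x => by
    rw [LinearMap.mem_ker, ← LinearMap.comp_apply, comp_norm, ← LinearMap.comp_assoc,
      liftInd_comp_unitInd, LinearMap.id_comp, hc, LinearMap.zero_apply]

lemma coeffAt_norm_sub_liftInd_mem (D : X →ₗ[k] TensorProduct k (MonoidAlgebra k G) Y) :
    coeffAt (1 : G) ∘ₗ (norm (G := G) D).restrictScalars k -
      (liftInd (G := G) LinearMap.id).restrictScalars k ∘ₗ D
      ∈ augHom k G X Y := by
  have : coeffAt (1 : G) ∘ₗ (norm (G := G) D).restrictScalars k -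
      (liftInd (G := G) LinearMap.id).restrictScalars k ∘ₗ D =
      ∑ g : G, ((coeffAt g ∘ₗ D) ∘ₗ translate k X g - translate k Y g ∘ₗ (coeffAt g ∘ₗ D)) := by
    ext x
    simp [norm_apply, liftInd_id_eq_sum, coeffAt_translate, map_sum]
  rw [this]
  exact Submodule.sum_mem _ fun g _ => commutator_mem_augHom g _

lemma mem_augHom_of_isNorm {c : X →ₗ[k] Y} {hc : norm (G := G) c = 0}
    (h : IsNorm (Y := syzygy k G Y) (toSyzygy c hc)) : c ∈ augHom k G X Y := by
  classical
  obtain ⟨D, hD⟩ := h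
  have h1 := coeffAt_norm_sub_liftInd_mem (G := G)
    ((syzygy k G Y).subtype.restrictScalars k ∘ₗ D)
  rw [← comp_norm (Y := syzygy k G Y), ← hD] at h1
  convert h1 using 1
  ext x
  have h2 : liftInd (G := G) LinearMap.id (D x).1 = 0 := (D x).2
  simp [toSyzygy, norm_apply, h2, map_sum, coeffAt_translate, coeffAt_unitInd, translate_one_apply]

lemma isNorm_of_mem_augHom {c : X →ₗ[k] Y} (hc : norm (G := G) c = 0)
    (h : c ∈ augHom k G X Y) : IsNorm (Y := syzygy k G Y) (toSyzygy c hc) := by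
  suffices ∃ D : X →ₗ[k] TensorProduct k (MonoidAlgebra k G) Y,
      (∀ x, liftInd (G := G) LinearMap.id (D x) = 0) ∧
        norm (G := G) D = norm (unitInd k G Y ∘ₗ c) by
    obtain ⟨D, hD, hn⟩ := this
    let D' : X →ₗ[k] syzygy k G Y :=
      { toFun := fun x => ⟨D x, LinearMap.mem_ker.2 (hD x)⟩
        map_add' := fun x y => Subtype.ext (map_add D x y)
        map_smul' := fun t x => Subtype.ext (map_smul D t x) }
    refine ⟨D', LinearMap.ext fun x => Subtype.ext ?_⟩
    have h1 := LinearMap.congr_fun (comp_norm (Y := syzygy k G Y) (syzygy k G Y).subtype D') x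
    have h2 : (syzygy k G Y).subtype.restrictScalars k ∘ₗ D' = D := rfl
    rw [h2, hn] at h1
    exact h1.symm
  clear hc
  induction h using Submodule.span_induction with
  | mem c hc =>
    obtain ⟨g, d, rfl⟩ := hc
    refine ⟨translate k _ g ∘ₗ unitInd k G Y ∘ₗ d - unitInd k G Y ∘ₗ translate k Y g ∘ₗ d, ?_, ?_⟩
    · intro x
      simp [map_translate, unitInd, liftInd_tmul]
    · rw [norm_sub, norm_translate_comp, ← norm_sub]
      congr 1
      ext x
      simp
  | zero => exact ⟨0, by simp, by simp⟩
  | add a b _ _ ha hb =>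
    obtain ⟨D, hD, hn⟩ := ha
    obtain ⟨D', hD', hn'⟩ := hb
    exact ⟨D + D', fun x => by simp [hD, hD'], by
      rw [LinearMap.comp_add, norm_add, norm_add, hn, hn']⟩
  | smul t a _ ha =>
    obtain ⟨D, hD, hn⟩ := ha
    refine ⟨t • D, fun x => ?_, ?_⟩
    · rw [LinearMap.smul_apply, ← LinearMap.restrictScalars_apply k, map_smul]
      simp [hD]
    · ext x
      rw [LinearMap.comp_smul, norm_smul_apply, norm_smul_apply, hn]

end Duality

section Ghost

variable {k G : Type} [Field k] [Group G] [Fintype G]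
variable {X Y Z : Type}
  [AddCommGroup X] [Module k X] [Module (MonoidAlgebra k G) X] [IsScalarTower k (MonoidAlgebra k G) X]
  [AddCommGroup Y] [Module k Y] [Module (MonoidAlgebra k G) Y] [IsScalarTower k (MonoidAlgebra k G) Y]
  [AddCommGroup Z] [Module k Z] [Module (MonoidAlgebra k G) Z] [IsScalarTower k (MonoidAlgebra k G) Z]

lemma trace_norm_comp [FiniteDimensional k X] [FiniteDimensional k Y] (b : Y →ₗ[k] X)
    (d : X →ₗ[k] Y) :
    LinearMap.trace k X ((norm (G := G) b).restrictScalars k ∘ₗ d) =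
      LinearMap.trace k X (b ∘ₗ (norm (G := G) d).restrictScalars k) := by
  have h1 : (norm (G := G) b).restrictScalars k ∘ₗ d =
      ∑ g : G, translate k X g⁻¹ ∘ₗ (b ∘ₗ translate k Y g ∘ₗ d) := by
    ext x; simp [norm_apply]
  have h2 : b ∘ₗ (norm (G := G) d).restrictScalars k =
      ∑ g : G, (b ∘ₗ translate k Y g⁻¹ ∘ₗ d) ∘ₗ translate k X g := by
    ext x; simp [norm_apply]
  rw [h1, h2, map_sum, map_sum]
  refine Fintype.sum_equiv (Equiv.inv G) _ _ fun g => ?_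
  rw [LinearMap.trace_comp_comm']
  simp

lemma toSyzygy_comp (c : Y →ₗ[k] Z) (hc : norm (G := G) c = 0)
    (f : X →ₗ[MonoidAlgebra k G] Y) (hcf : norm (G := G) (c ∘ₗ f.restrictScalars k) = 0) :
    toSyzygy c hc ∘ₗ f = toSyzygy (c ∘ₗ f.restrictScalars k) hcf :=
  LinearMap.ext fun x => Subtype.ext
    (LinearMap.congr_fun (norm_comp (unitInd k G Z ∘ₗ c) f) x)

variable {ι : Type} (Ω : ι → Type) [∀ i, AddCommGroup (Ω i)] [∀ i, Module k (Ω i)]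
  [∀ i, Module (MonoidAlgebra k G) (Ω i)] [∀ i, IsScalarTower k (MonoidAlgebra k G) (Ω i)]

/-- The map factors stably through a finite direct sum of members of the family `Ω`. -/
def SumFactor (f : X →ₗ[MonoidAlgebra k G] Y) : Prop :=
  ∃ (J : Type) (_ : Fintype J) (c : J → ι) (α : ∀ j, X →ₗ[MonoidAlgebra k G] Ω (c j))
    (β : ∀ j, Ω (c j) →ₗ[MonoidAlgebra k G] Y), IsNorm (∑ j, β j ∘ₗ α j - f)

variable {Ω}

lemma SumFactor.of_isNorm {f : X →ₗ[MonoidAlgebra k G] Y} (hf : IsNorm f) : SumFactor Ω f :=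
  ⟨Empty, inferInstance, Empty.elim, fun j => j.elim, fun j => j.elim, by
    simpa using hf.neg⟩

lemma sumFactor_comp {i : ι} (v : X →ₗ[MonoidAlgebra k G] Ω i) (u : Ω i →ₗ[MonoidAlgebra k G] Y) :
    SumFactor Ω (u ∘ₗ v) :=
  ⟨Unit, inferInstance, fun _ => i, fun _ => v, fun _ => u, by simpa using IsNorm.zero⟩

lemma SumFactor.add {f g : X →ₗ[MonoidAlgebra k G] Y} (hf : SumFactor Ω f)
    (hg : SumFactor Ω g) : SumFactor Ω (f + g) := by
  obtain ⟨J, _, c, α, β, h⟩ := hf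
  obtain ⟨J', _, c', α', β', h'⟩ := hg
  refine ⟨J ⊕ J', inferInstance, Sum.elim c c', Sum.rec α α', Sum.rec β β', ?_⟩
  convert h.add h' using 1
  rw [Fintype.sum_sum_type, add_sub_add_comm]
  rfl

lemma SumFactor.comp_left {f : X →ₗ[MonoidAlgebra k G] Y} (hf : SumFactor Ω f)
    (g : Y →ₗ[MonoidAlgebra k G] Z) : SumFactor Ω (g ∘ₗ f) := by
  obtain ⟨J, _, c, α, β, h⟩ := hf
  refine ⟨J, inferInstance, c, α, fun j => g ∘ₗ β j, ?_⟩
  convert h.comp_left g using 1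
  ext x
  simp

lemma SumFactor.comp_right {f : Y →ₗ[MonoidAlgebra k G] Z} (hf : SumFactor Ω f)
    (g : X →ₗ[MonoidAlgebra k G] Y) : SumFactor Ω (f ∘ₗ g) := by
  obtain ⟨J, _, c, α, β, h⟩ := hf
  refine ⟨J, inferInstance, c, fun j => α j ∘ₗ g, β, ?_⟩
  convert h.comp_right g using 1
  ext x
  simp

variable (Ω) in
/-- The endomorphisms factoring stably through a finite direct sum of members of `Ω`. -/
def sumFactorSubmodule (X : Type) [AddCommGroup X] [Module k X] [Module (MonoidAlgebra k G) X]
    [IsScalarTower k (MonoidAlgebra k G) X] : Submodule k (X →ₗ[k] X) where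
  carrier := {d | ∃ f : X →ₗ[MonoidAlgebra k G] X, f.restrictScalars k = d ∧ SumFactor Ω f}
  zero_mem' := ⟨0, rfl, .of_isNorm .zero⟩
  add_mem' := by
    rintro _ _ ⟨f, rfl, hf⟩ ⟨g, rfl, hg⟩
    exact ⟨f + g, rfl, hf.add hg⟩
  smul_mem' := by
    rintro t _ ⟨f, rfl, hf⟩
    exact ⟨(t • LinearMap.id) ∘ₗ f, rfl, hf.comp_left _⟩

/-- A module which is a stable retract of a finite-dimensional one, but not of a finite direct
sum of members of `Ω`, has a nonzero stable map to its syzygy that vanishes on all maps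
from members of `Ω`. -/
lemma exists_ghost [∀ i, FiniteDimensional k (Ω i)] [FiniteDimensional k Y]
    (a : X →ₗ[MonoidAlgebra k G] Y) (r : Y →ₗ[MonoidAlgebra k G] X)
    (hra : IsNorm (r ∘ₗ a - LinearMap.id))
    (hX : ¬ SumFactor Ω (LinearMap.id : X →ₗ[MonoidAlgebra k G] X)) :
    ∃ f : X →ₗ[MonoidAlgebra k G] syzygy k G X,
      (∀ (i : ι) (g : Ω i →ₗ[MonoidAlgebra k G] X), IsNorm (Y := syzygy k G X) (f ∘ₗ g)) ∧
        ¬ IsNorm (Y := syzygy k G X) f := by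
  have he : (a ∘ₗ r).restrictScalars k ∉ sumFactorSubmodule (k := k) (G := G) Ω Y := by
    rintro ⟨f, hf, hs⟩
    obtain rfl : f = a ∘ₗ r := LinearMap.restrictScalars_injective k hf
    refine hX ?_
    have h1 : IsNorm ((LinearMap.id : X →ₗ[MonoidAlgebra k G] X) - r ∘ₗ (a ∘ₗ r) ∘ₗ a) := by
      convert (hra.comp_right (r ∘ₗ a)).neg.sub hra using 1
      ext x
      simp
    convert (SumFactor.of_isNorm h1).add ((hs.comp_left r).comp_right a) using 1
    ext x
    simp
  obtain ⟨ψ, hψe, hψ⟩ := Submodule.exists_le_ker_of_notMem he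
  obtain ⟨b, hb⟩ := exists_trace_rep ψ
  have hψ' : ∀ f : Y →ₗ[MonoidAlgebra k G] Y, SumFactor Ω f →
      LinearMap.trace k Y (b ∘ₗ f.restrictScalars k) = 0 := fun f hf => by
    rw [← hb]
    exact hψ ⟨f, rfl, hf⟩
  have hnb : norm (G := G) b = 0 := by
    refine LinearMap.restrictScalars_injective k (eq_zero_of_trace_comp _ fun d => ?_)
    rw [trace_norm_comp]
    exact hψ' _ (.of_isNorm (isNorm_norm d))
  have hβ : norm (G := G) (r.restrictScalars k ∘ₗ b ∘ₗ a.restrictScalars k) = 0 := by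
    rw [← comp_norm, ← norm_comp, hnb, LinearMap.zero_comp, LinearMap.comp_zero]
  refine ⟨toSyzygy _ hβ, fun i g => ?_, fun hn => hψe ?_⟩
  · have hβg : norm (G := G) ((r.restrictScalars k ∘ₗ b ∘ₗ a.restrictScalars k) ∘ₗ
        g.restrictScalars k) = 0 := by
      rw [← norm_comp, hβ, LinearMap.zero_comp]
    rw [toSyzygy_comp _ _ _ hβg]
    refine isNorm_of_mem_augHom _ ?_
    refine comp_mem_augHom r (c := b ∘ₗ (a ∘ₗ g).restrictScalars k) ?_
    refine mem_augHom_of_trace _ fun h => ?_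
    rw [LinearMap.trace_comp_comm', LinearMap.comp_assoc]
    exact hψ' _ (sumFactor_comp h (a ∘ₗ g))
  · have h1 := trace_eq_zero_of_mem_augHom
      (mem_augHom_comp r (comp_mem_augHom a (mem_augHom_of_isNorm hn)))
    have h2 : IsNorm ((a ∘ₗ r) ∘ₗ (a ∘ₗ r) - a ∘ₗ r) := by
      convert (hra.comp_left a).comp_right r using 1
      ext x
      simp
    have h3 := hψ' _ (.of_isNorm h2)
    have h4 : (a.restrictScalars k ∘ₗ r.restrictScalars k ∘ₗ b ∘ₗ a.restrictScalars k) ∘ₗ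
        r.restrictScalars k = (a ∘ₗ r).restrictScalars k ∘ₗ (b ∘ₗ (a ∘ₗ r).restrictScalars k) := rfl
    have h5 : b ∘ₗ ((a ∘ₗ r) ∘ₗ (a ∘ₗ r) - a ∘ₗ r).restrictScalars k =
        (b ∘ₗ (a ∘ₗ r).restrictScalars k) ∘ₗ (a ∘ₗ r).restrictScalars k -
          b ∘ₗ (a ∘ₗ r).restrictScalars k := by
      ext x
      simp
    rw [h4, LinearMap.trace_comp_comm'] at h1
    rw [h5, map_sub, h1, zero_sub, neg_eq_zero] at h3
    rw [hb, h3]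

end Ghost

section EndScalar

variable {k G : Type} [Field k] [Group G] [Fintype G]
variable {X Y Z P : Type}
  [AddCommGroup X] [Module k X] [Module (MonoidAlgebra k G) X] [IsScalarTower k (MonoidAlgebra k G) X]
  [AddCommGroup Y] [Module k Y] [Module (MonoidAlgebra k G) Y] [IsScalarTower k (MonoidAlgebra k G) Y]
  [AddCommGroup Z] [Module k Z] [Module (MonoidAlgebra k G) Z] [IsScalarTower k (MonoidAlgebra k G) Z]
  [AddCommGroup P] [Module k P] [Module (MonoidAlgebra k G) P] [IsScalarTower k (MonoidAlgebra k G) P]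

variable (k G X) in
/-- Every endomorphism is stably a scalar. -/
def EndScalar : Prop :=
  ∀ u : X →ₗ[MonoidAlgebra k G] X, ∃ t : k, IsNorm (u - t • LinearMap.id)

lemma EndScalar.of_retract (h : EndScalar k G Y) (s : X →ₗ[MonoidAlgebra k G] Y)
    (r : Y →ₗ[MonoidAlgebra k G] X) (hrs : IsNorm (r ∘ₗ s - LinearMap.id)) :
    EndScalar k G X := by
  intro u
  obtain ⟨t, ht⟩ := h (s ∘ₗ u ∘ₗ r)
  refine ⟨t, ?_⟩
  have h1 := (ht.comp_left r).comp_right s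
  have h2 := hrs.comp_right (u ∘ₗ r ∘ₗ s)
  have h3 := hrs.comp_left u
  have h4 := hrs.comp_left (t • LinearMap.id)
  convert ((h1.add h4).sub h2).sub h3 using 1
  ext x
  simp [smul_sub]

variable {i : X →ₗ[MonoidAlgebra k G] P} {p : P →ₗ[MonoidAlgebra k G] Z}
  [Module.Projective (MonoidAlgebra k G) P]

lemma EndScalar.left (hi : Function.Injective i) (hp : Function.Surjective p)
    (hex : ∀ y, p y = 0 ↔ ∃ x, i x = y) (hZ : EndScalar k G Z) : EndScalar k G X := by
  intro u
  have hpi : ∀ x, p (i x) = 0 := fun x => (hex _).2 ⟨x, rfl⟩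
  obtain ⟨U, -, hU⟩ := (isNorm_of_projective (k := k) (i ∘ₗ u)).exists_extend i hi
  obtain ⟨h, hh⟩ := exists_descend hp hex (p ∘ₗ U) (by
    rw [LinearMap.comp_assoc, hU]
    ext x
    simp [hpi])
  obtain ⟨c, hc⟩ := hZ h
  obtain ⟨t, -, ht⟩ := hc.exists_lift p hp
  obtain ⟨w, hw⟩ := exists_factor_kernel hi hex (U - c • LinearMap.id - t ∘ₗ p) (by
    ext y
    have h1 := LinearMap.congr_fun hh y
    have h2 := LinearMap.congr_fun ht (p y)
    simp only [LinearMap.comp_apply, LinearMap.sub_apply, LinearMap.smul_apply,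
      LinearMap.id_apply, map_sub, LinearMap.zero_apply] at h1 h2 ⊢
    rw [h2, h1, LinearMap.map_smul_of_tower]
    abel)
  refine ⟨c, ?_⟩
  have : u - c • LinearMap.id = w ∘ₗ i := by
    ext x
    apply hi
    have h1 := LinearMap.congr_fun hw (i x)
    have h2 := LinearMap.congr_fun hU x
    simp only [LinearMap.comp_apply, LinearMap.sub_apply, LinearMap.smul_apply,
      LinearMap.id_apply, hpi, map_zero, sub_zero] at h1 h2
    simp only [LinearMap.comp_apply, LinearMap.sub_apply, LinearMap.smul_apply,
      LinearMap.id_apply, map_sub, LinearMap.map_smul_of_tower]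
    rw [h1, h2]
  rw [this]
  exact isNorm_comp_of_projective i w

lemma EndScalar.right (hi : Function.Injective i) (hp : Function.Surjective p)
    (hex : ∀ y, p y = 0 ↔ ∃ x, i x = y) (hX : EndScalar k G X) : EndScalar k G Z := by
  intro u
  have hpi : ∀ x, p (i x) = 0 := fun x => (hex _).2 ⟨x, rfl⟩
  obtain ⟨U, -, hU⟩ := (isNorm_of_projective_domain (k := k) (u ∘ₗ p)).exists_lift p hp
  obtain ⟨h, hh⟩ := exists_factor_kernel hi hex (U ∘ₗ i) (by
    rw [← LinearMap.comp_assoc, hU]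
    ext x
    simp [hpi])
  obtain ⟨c, hc⟩ := hX h
  obtain ⟨t, -, ht⟩ := hc.exists_extend i hi
  obtain ⟨w, hw⟩ := exists_descend hp hex (U - c • LinearMap.id - i ∘ₗ t) (by
    ext x
    have h1 := LinearMap.congr_fun hh x
    have h2 := LinearMap.congr_fun ht x
    simp only [LinearMap.comp_apply, LinearMap.sub_apply, LinearMap.smul_apply,
      LinearMap.id_apply, LinearMap.zero_apply] at h1 h2 ⊢
    rw [h2, map_sub, h1, LinearMap.map_smul_of_tower]
    abel)
  refine ⟨c, ?_⟩
  have : u - c • LinearMap.id = p ∘ₗ w := by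
    ext z
    obtain ⟨y, rfl⟩ := hp z
    have h1 := congrArg p (LinearMap.congr_fun hw y)
    have h2 := LinearMap.congr_fun hU y
    simp only [LinearMap.comp_apply, LinearMap.sub_apply, LinearMap.smul_apply,
      LinearMap.id_apply, hpi, map_sub, sub_zero, LinearMap.map_smul_of_tower] at h1 h2
    simp only [LinearMap.comp_apply, LinearMap.sub_apply, LinearMap.smul_apply,
      LinearMap.id_apply]
    rw [h1, h2]
  rw [this]
  exact isNorm_comp_of_projective w p

end EndScalar

section Decomposition

variable {k G : Type} [Field k] [Group G] [Fintype G]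
variable {M X : Type}
  [AddCommGroup M] [Module k M] [Module (MonoidAlgebra k G) M] [IsScalarTower k (MonoidAlgebra k G) M]
  [AddCommGroup X] [Module k X] [Module (MonoidAlgebra k G) X] [IsScalarTower k (MonoidAlgebra k G) X]

/-- A stable retract has a stable complement. -/
lemma exists_complement (s : X →ₗ[MonoidAlgebra k G] M) (t : M →ₗ[MonoidAlgebra k G] X)
    (hts : IsNorm (t ∘ₗ s - LinearMap.id)) :
    ∃ (M' : Type) (_ : AddCommGroup M') (_ : Module k M') (_ : Module (MonoidAlgebra k G) M')
      (_ : IsScalarTower k (MonoidAlgebra k G) M') (u : M' →ₗ[MonoidAlgebra k G] M)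
      (v : M →ₗ[MonoidAlgebra k G] M'),
      IsNorm (v ∘ₗ u - LinearMap.id) ∧ u ∘ₗ v + s ∘ₗ t = LinearMap.id := by
  obtain ⟨d, hd⟩ := hts
  rw [norm_eq_liftInd_comp] at hd
  have hd' : ∀ x, liftInd d (norm (unitInd k G X) x) = t (s x) - x := fun x =>
    (LinearMap.congr_fun hd x).symm
  let σ := s.prod (norm (unitInd k G X))
  let τ := t.coprod (-liftInd (G := G) d)
  have hτσ : ∀ x, τ (σ x) = x := fun x => by simp [σ, τ, hd']
  let π : M × TensorProduct k (MonoidAlgebra k G) X →ₗ[MonoidAlgebra k G] LinearMap.ker τ :=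
    (LinearMap.id - σ ∘ₗ τ).codRestrict _ fun y => by simp [hτσ]
  refine ⟨LinearMap.ker τ, inferInstance, inferInstance, inferInstance, inferInstance,
    LinearMap.fst _ _ _ ∘ₗ (LinearMap.ker τ).subtype, π ∘ₗ LinearMap.inl _ _ _, ?_, ?_⟩
  · have hπ : ∀ y : LinearMap.ker τ, π y = y := fun y => Subtype.ext (by
      have : τ y = 0 := y.2
      simp [π, this])
    convert (isNorm_comp_of_projective (X := LinearMap.ker τ) (Z := LinearMap.ker τ)
      (Y := TensorProduct k (MonoidAlgebra k G) X)
      (LinearMap.snd _ _ _ ∘ₗ (LinearMap.ker τ).subtype) (π ∘ₗ LinearMap.inr _ _ _)).neg using 1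
    ext1 y
    have h1 : π (LinearMap.inr (MonoidAlgebra k G) _ _ y.1.2) +
        π (LinearMap.inl (MonoidAlgebra k G) _ _ y.1.1) = y := by
      rw [← map_add, LinearMap.inl_apply, LinearMap.inr_apply, add_comm, Prod.fst_add_snd, hπ]
    exact Subtype.ext (sub_eq_iff_eq_add.2 (eq_neg_add_of_add_eq (congrArg Subtype.val h1)))
  · ext m
    simp [π, σ, τ]

lemma isNorm_pi {J : Type} {N : J → Type} [∀ j, AddCommGroup (N j)] [∀ j, Module k (N j)]
    [∀ j, Module (MonoidAlgebra k G) (N j)] [∀ j, IsScalarTower k (MonoidAlgebra k G) (N j)]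
    {f : M →ₗ[MonoidAlgebra k G] ∀ j, N j} (hf : ∀ j, IsNorm (LinearMap.proj j ∘ₗ f)) :
    IsNorm f := by
  choose d hd using hf
  refine ⟨LinearMap.pi d, ?_⟩
  ext x j
  have h1 := LinearMap.congr_fun (hd j) x
  have h2 := LinearMap.congr_fun
    (comp_norm (LinearMap.proj (R := MonoidAlgebra k G) (φ := N) j) (LinearMap.pi d)) x
  exact h1.trans h2.symm

variable {ι : Type} {Ω : ι → Type} [∀ i, AddCommGroup (Ω i)] [∀ i, Module k (Ω i)]
  [∀ i, Module (MonoidAlgebra k G) (Ω i)] [∀ i, IsScalarTower k (MonoidAlgebra k G) (Ω i)]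

lemma exists_stable_decomposition (hΩ : ∀ i, EndScalar k G (Ω i)) {n : ℕ} (c : Fin n → ι)
    (α : ∀ j, M →ₗ[MonoidAlgebra k G] Ω (c j)) (β : ∀ j, Ω (c j) →ₗ[MonoidAlgebra k G] M)
    (h : IsNorm (∑ j, β j ∘ₗ α j - LinearMap.id)) :
    ∃ (m : ℕ) (e : Fin m → ι) (f : M →ₗ[MonoidAlgebra k G] ∀ j, Ω (e j))
      (g : (∀ j, Ω (e j)) →ₗ[MonoidAlgebra k G] M),
      IsNorm (g ∘ₗ f - LinearMap.id) ∧ IsNorm (f ∘ₗ g - LinearMap.id) := by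
  induction n generalizing M with
  | zero =>
    refine ⟨0, c, 0, 0, by simpa using h, isNorm_pi fun j => j.elim0⟩
  | succ n ih =>
    rw [Fin.sum_univ_succ] at h
    obtain ⟨r, hr⟩ := hΩ _ (α 0 ∘ₗ β 0)
    by_cases hr0 : r = 0
    · rw [hr0, zero_smul, sub_zero] at hr
      refine ih (fun j => c j.succ) (fun j => α j.succ ∘ₗ (LinearMap.id + β 0 ∘ₗ α 0))
        (fun j => β j.succ) ?_
      convert (h.comp_right (LinearMap.id + β 0 ∘ₗ α 0)).sub
        ((hr.comp_left (β 0)).comp_right (α 0)) using 1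
      ext x
      simp [Finset.sum_add_distrib]
      abel
    · have hts : IsNorm ((r⁻¹ • α 0) ∘ₗ β 0 - LinearMap.id) := by
        convert hr.comp_left (r⁻¹ • LinearMap.id) using 1
        ext x
        simp [smul_sub, smul_smul, hr0]
      generalize ht : r⁻¹ • α 0 = t at hts
      obtain ⟨M', _, _, _, _, u, v, hvu, huv⟩ := exists_complement _ _ hts
      have huv' : ∀ x, u (v x) = x - β 0 (t x) := fun x =>
        eq_sub_of_add_eq (LinearMap.congr_fun huv x)
      have hvs : IsNorm (v ∘ₗ β 0) := by
        convert (((hvu.comp_right v).comp_right (β 0)).neg.sub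
          (hts.comp_left (v ∘ₗ β 0))) using 1
        ext x
        simp [huv']
      have htu : IsNorm (t ∘ₗ u) := by
        convert ((hvu.comp_left (t ∘ₗ u)).neg.sub (hts.comp_right (t ∘ₗ u))) using 1
        ext x
        simp [huv']
      have hα : ∀ x, α 0 x = r • t x := fun x => by simp [← ht, smul_smul, hr0]
      obtain ⟨m, e, f, g, hgf, hfg⟩ := ih (fun j => c j.succ) (fun j => α j.succ ∘ₗ u)
        (fun j => v ∘ₗ β j.succ) (by
          convert (((h.comp_left v).comp_right u).sub
            ((hvs.comp_right ((r • LinearMap.id) ∘ₗ t ∘ₗ u)))).add hvu using 1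
          ext x
          simp [hα]
          abel)
      let pr : (∀ j : Fin (m + 1), Ω ((Fin.cons (c 0) e : Fin (m + 1) → ι) j))
          →ₗ[MonoidAlgebra k G] ∀ j, Ω (e j) := LinearMap.pi fun j => LinearMap.proj j.succ
      let p₀ : (∀ j : Fin (m + 1), Ω ((Fin.cons (c 0) e : Fin (m + 1) → ι) j))
          →ₗ[MonoidAlgebra k G] Ω (c 0) := LinearMap.proj 0
      let F : M →ₗ[MonoidAlgebra k G] ∀ j, Ω ((Fin.cons (c 0) e : Fin (m + 1) → ι) j) :=
        LinearMap.pi (Fin.cases t fun j => LinearMap.proj j ∘ₗ f ∘ₗ v)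
      have hp₀F : p₀ ∘ₗ F = t := rfl
      have hprF : pr ∘ₗ F = f ∘ₗ v := rfl
      refine ⟨m + 1, Fin.cons (c 0) e, F, β 0 ∘ₗ p₀ + u ∘ₗ g ∘ₗ pr, ?_, ?_⟩
      · convert (hgf.comp_left u).comp_right v using 1
        rw [LinearMap.add_comp, LinearMap.comp_assoc, hp₀F, LinearMap.comp_assoc,
          LinearMap.comp_assoc, hprF]
        ext x
        simp [huv']
        abel
      · refine isNorm_pi fun j => ?_
        induction j using Fin.cases with
        | zero =>
          change IsNorm (t ∘ₗ (β 0 ∘ₗ p₀ + u ∘ₗ g ∘ₗ pr) - p₀)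
          convert (hts.comp_right p₀).add (htu.comp_right (g ∘ₗ pr)) using 1
          ext x
          simp
          abel
        | succ j =>
          change IsNorm ((LinearMap.proj j ∘ₗ f ∘ₗ v) ∘ₗ (β 0 ∘ₗ p₀ + u ∘ₗ g ∘ₗ pr) -
            LinearMap.proj j ∘ₗ pr)
          convert (((hvs.comp_left f).comp_right p₀).add
            (((hvu.comp_left f).comp_right (g ∘ₗ pr)).add
              (hfg.comp_right pr))).comp_left (LinearMap.proj j) using 1
          ext x
          simp
          abel

lemma SumFactor.exists_stable_decomposition (hΩ : ∀ i, EndScalar k G (Ω i))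
    (h : SumFactor Ω (LinearMap.id : M →ₗ[MonoidAlgebra k G] M)) :
    ∃ (m : ℕ) (e : Fin m → ι) (f : M →ₗ[MonoidAlgebra k G] ∀ j, Ω (e j))
      (g : (∀ j, Ω (e j)) →ₗ[MonoidAlgebra k G] M),
      IsNorm (g ∘ₗ f - LinearMap.id) ∧ IsNorm (f ∘ₗ g - LinearMap.id) := by
  obtain ⟨J, _, c, α, β, h⟩ := h
  let E := (Fintype.equivFin J).symm
  refine StmodGH.exists_stable_decomposition hΩ (fun j => c (E j)) (fun j => α (E j))
    (fun j => β (E j)) ?_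
  rwa [E.sum_comp fun j => β j ∘ₗ α j]

end Decomposition

section StableCategory

open scoped ModuleCat

variable {k G : Type} [Field k] [Group G] [Fintype G]
variable {X Y : Type}
  [AddCommGroup X] [Module k X] [Module (MonoidAlgebra k G) X] [IsScalarTower k (MonoidAlgebra k G) X]
  [AddCommGroup Y] [Module k Y] [Module (MonoidAlgebra k G) Y] [IsScalarTower k (MonoidAlgebra k G) Y]

lemma stablyZero_ofHom_iff {f : X →ₗ[MonoidAlgebra k G] Y} :
    StablyZero (ModuleCat.ofHom f) ↔ IsNorm f := by
  constructor
  · rintro ⟨P, hP, g, h, e⟩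
    have : Module.Projective (MonoidAlgebra k G) P := (IsProjective.iff_projective P).2 hP
    rw [show f = h.hom ∘ₗ g.hom from congrArg ModuleCat.Hom.hom e]
    exact isNorm_comp_of_projective (Y := P) g.hom h.hom
  · rintro ⟨d, rfl⟩
    rw [norm_eq_liftInd_comp]
    exact ⟨ModuleCat.of (MonoidAlgebra k G) (TensorProduct k (MonoidAlgebra k G) X),
      (IsProjective.iff_projective _).1 inferInstance, ModuleCat.ofHom _, ModuleCat.ofHom _, rfl⟩

lemma stablyZero_iff {M N : ModuleCat.{0} (MonoidAlgebra k G)} {f : M ⟶ N} :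
    StablyZero f ↔ IsNorm f.hom :=
  stablyZero_ofHom_iff (f := f.hom)

lemma StablyIso.exists_isNorm {M N : ModuleCat.{0} (MonoidAlgebra k G)} (h : StablyIso M N) :
    ∃ (f : M →ₗ[MonoidAlgebra k G] N) (g : N →ₗ[MonoidAlgebra k G] M),
      IsNorm (g ∘ₗ f - LinearMap.id) ∧ IsNorm (f ∘ₗ g - LinearMap.id) := by
  obtain ⟨f, g, hfg, hgf⟩ := h
  exact ⟨f.hom, g.hom, stablyZero_iff.1 hfg, stablyZero_iff.1 hgf⟩

variable (k G) in
lemma finite_triv : Module.Finite (MonoidAlgebra k G) (triv k G) :=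
  Module.Finite.of_restrictScalars_finite k (MonoidAlgebra k G)
    (Representation.trivial k (G := G) (V := k)).asModule

lemma finiteDimensional_of_finite (M : ModuleCat (MonoidAlgebra k G))
    (h : Module.Finite (MonoidAlgebra k G) M) : FiniteDimensional k M :=
  Module.Finite.trans (MonoidAlgebra k G) M

lemma InThick.finApprox {M : ModuleCat (MonoidAlgebra k G)} (h : InThick (triv k G) M) :
    FinApprox k G M := by
  induction h with
  | gen =>
    have := finiteDimensional_of_finite _ (finite_triv k G)
    exact finApprox_of_finite
  | proj P hP =>
    have : Module.Projective (MonoidAlgebra k G) P := (IsProjective.iff_projective P).2 hP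
    exact finApprox_of_projective
  | iso e _ ih =>
    obtain ⟨f, g, -, hfg⟩ := e.exists_isNorm
    exact ih.of_retract g f hfg
  | ext₁ s _ _ ihX ihY => exact ihX.right (i := s.i.hom) (p := s.p.hom) s.inj s.surj s.exact ihY
  | ext₂ s _ _ ihX ihZ => exact ihX.middle (i := s.i.hom) (p := s.p.hom) s.inj s.surj s.exact ihZ
  | ext₃ s _ _ ihY ihZ => exact ihY.left (i := s.i.hom) (p := s.p.hom) s.inj s.surj s.exact ihZ
  | summand e _ ih =>
    obtain ⟨s, r, hsr⟩ := e
    refine ih.of_retract s.hom r.hom ?_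
    rw [show r.hom ∘ₗ s.hom = LinearMap.id from congrArg ModuleCat.Hom.hom hsr, sub_self]
    exact IsNorm.zero

variable (k G) in
lemma endScalar_triv : EndScalar k G (triv k G) := by
  let V := (Representation.trivial k (G := G) (V := k)).asModule
  have hV : EndScalar k G V := fun u => by
    let e : V ≃ₗ[k] k := Representation.asModuleEquiv _
    refine ⟨e (u (e.symm 1)), ?_⟩
    suffices u - e (u (e.symm 1)) • LinearMap.id = 0 by rw [this]; exact .zero
    ext x
    apply e.injective
    have hx : x = e x • e.symm 1 := e.injective (by simp)
    rw [LinearMap.sub_apply, LinearMap.smul_apply, LinearMap.id_apply, LinearMap.zero_apply,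
      map_sub, map_smul, map_zero]
    nth_rw 1 [hx]
    rw [LinearMap.map_smul_of_tower, map_smul, smul_eq_mul, smul_eq_mul, mul_comm, sub_self]
  refine hV.of_retract (X := triv k G) (LinearMap.id : V →ₗ[MonoidAlgebra k G] V)
    (LinearMap.id : V →ₗ[MonoidAlgebra k G] V) ⟨0, ?_⟩
  rw [norm_zero]
  exact sub_self _

lemma IsSyzygyFamily.endScalar {Ωk : ℤ → ModuleCat.{0} (MonoidAlgebra k G)}
    (h : IsSyzygyFamily (triv k G) Ωk) (i : ℤ) : EndScalar k G (Ωk i) := by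
  obtain ⟨-, h0, hs⟩ := h
  have step : ∀ i, EndScalar k G (Ωk i) ↔ EndScalar k G (Ωk (i + 1)) := fun i => by
    obtain ⟨P, hP, ⟨s⟩⟩ := hs i
    have : Module.Projective (MonoidAlgebra k G) P := (IsProjective.iff_projective P).2 hP
    exact ⟨fun h => h.left (i := s.i.hom) (p := s.p.hom) s.inj s.surj s.exact,
      fun h => h.right (i := s.i.hom) (p := s.p.hom) s.inj s.surj s.exact⟩
  induction i using Int.induction_on with
  | zero =>
    obtain ⟨f, g, hgf, -⟩ := h0.exists_isNorm
    exact (endScalar_triv k G).of_retract f g hgf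
  | succ i ih => exact (step _).1 ih
  | pred i ih =>
    rw [step, sub_add_cancel]
    exact ih

/-- The first syzygy of an object of the thick subcategory lies in it. -/
lemma InThick.syzygy {M : ModuleCat (MonoidAlgebra k G)} (h : InThick (triv k G) M) :
    InThick (triv k G) (ModuleCat.of (MonoidAlgebra k G) (syzygy k G M)) :=
  InThick.ext₃ (Y := ModuleCat.of (MonoidAlgebra k G) (TensorProduct k (MonoidAlgebra k G) M))
    { i := ModuleCat.ofHom (StmodGH.syzygy k G M).subtype
      p := ModuleCat.ofHom (liftInd (LinearMap.id : M →ₗ[k] M))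
      inj := Subtype.val_injective
      surj := liftInd_id_surjective
      exact := fun y => ⟨fun hy => ⟨⟨y, hy⟩, rfl⟩, by rintro ⟨x, rfl⟩; exact x.2⟩ }
    (.proj _ ((IsProjective.iff_projective _).1 inferInstance)) h

variable {Ωk : ℤ → ModuleCat.{0} (MonoidAlgebra k G)}

lemma exists_stablyIso_pi_of_faithful (hΩk : IsSyzygyFamily (triv k G) Ωk)
    (hG : ∀ M N : ModuleCat (MonoidAlgebra k G), InThick (triv k G) M → InThick (triv k G) N →
        ∀ f : M ⟶ N, (∀ (i : ℤ) (g : Ωk i ⟶ M), StablyZero (g ≫ f)) → StablyZero f)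
    {M : ModuleCat (MonoidAlgebra k G)} (hM : InThick (triv k G) M) :
    ∃ (n : ℕ) (c : Fin n → ℤ),
      StablyIso M (ModuleCat.of (MonoidAlgebra k G) (∀ j : Fin n, Ωk (c j))) := by
  have hfin : ∀ i, FiniteDimensional k (Ωk i) := fun i =>
    finiteDimensional_of_finite _ (hΩk.1 i)
  have hM' : SumFactor (fun i => Ωk i) (LinearMap.id : M →ₗ[MonoidAlgebra k G] M) := by
    by_contra hne
    obtain ⟨F, a, _, ha⟩ := hM.finApprox.exists_retract
    obtain ⟨f, hf, hf'⟩ := exists_ghost (Y := F) a F.subtype ha hne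
    refine hf' (stablyZero_ofHom_iff.1 ?_)
    exact hG M _ hM hM.syzygy (ModuleCat.ofHom f) fun i g => stablyZero_ofHom_iff.2 (hf i g.hom)
  obtain ⟨m, e, f, g, hgf, hfg⟩ := hM'.exists_stable_decomposition hΩk.endScalar
  exact ⟨m, e, ModuleCat.ofHom f, ModuleCat.ofHom g, stablyZero_ofHom_iff.2 hgf,
    stablyZero_ofHom_iff.2 hfg⟩

/-- A map out of a stable direct sum of modules `Ωk i` is detected by maps from the `Ωk i`. -/
lemma StablyIso.stablyZero_of_forall {n : ℕ} {c : Fin n → ℤ} {M N : ModuleCat.{0} (MonoidAlgebra k G)}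
    (h : StablyIso M (ModuleCat.of (MonoidAlgebra k G) (∀ j : Fin n, Ωk (c j))))
    (f : M ⟶ N) (hf : ∀ (i : ℤ) (g : Ωk i ⟶ M), StablyZero (g ≫ f)) : StablyZero f := by
  obtain ⟨a, b, hba, -⟩ := h.exists_isNorm
  rw [stablyZero_iff]
  have h1 : IsNorm (∑ j, (f.hom ∘ₗ b ∘ₗ LinearMap.single (MonoidAlgebra k G)
      (fun j => Ωk (c j)) j) ∘ₗ (LinearMap.proj j ∘ₗ a)) :=
    IsNorm.sum _ fun j _ => (stablyZero_iff.1 (hf (c j) (ModuleCat.ofHom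
      (b ∘ₗ LinearMap.single (MonoidAlgebra k G) (fun j => Ωk (c j)) j)))).comp_right
        (LinearMap.proj j ∘ₗ a)
  convert h1.sub (hba.comp_left f.hom) using 1
  ext x
  have h2 : ∑ j, Pi.single j (a x j) = a x := Finset.univ_sum_single (a x)
  simp only [LinearMap.sub_apply, LinearMap.sum_apply, LinearMap.comp_apply, LinearMap.proj_apply,
    LinearMap.single_apply, ← map_sum, LinearMap.id_apply, map_sub, h2]
  abel

end StableCategory


/-- The Tate cohomology functor is faithful on `thick_G(k)` if and only if
every object of `thick_G(k)` is stably isomorphic to a finite direct sum of modules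
`Ω^i k`. -/
theorem faithful_iff_thick_is_sums_of_syzygies
    (k G : Type) [Field k] [Group G] [Fintype G]
    (p : ℕ) [Fact p.Prime] [CharP k p] (hp : p ∣ Fintype.card G)
    (Ωk : ℤ → ModuleCat (MonoidAlgebra k G)) (hΩk : IsSyzygyFamily (triv k G) Ωk) :
    (∀ M N : ModuleCat (MonoidAlgebra k G), InThick (triv k G) M → InThick (triv k G) N →
        ∀ f : M ⟶ N, (∀ (i : ℤ) (g : Ωk i ⟶ M), StablyZero (g ≫ f)) → StablyZero f) ↔
      (∀ M : ModuleCat (MonoidAlgebra k G), InThick (triv k G) M →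
        ∃ (n : ℕ) (c : Fin n → ℤ),
          StablyIso M (ModuleCat.of (MonoidAlgebra k G) (∀ j : Fin n, Ωk (c j)))) := by
  exact ⟨fun hG _ hM => exists_stablyIso_pi_of_faithful hΩk hG hM, fun hS M _ hM _ f hf =>
    (hS M hM).elim fun _ ⟨_, h⟩ => h.stablyZero_of_forall f hf⟩

end StmodGH
end

section
/- Let A be a finite dimensional symmetric k-algebra and L a finitely generated non-projective indecomposable A-module. Then the functor Hom_stmod(Ω^* L, −) is faithful on thick(L) if and only if every object of thick(L) is isomorphic in the stable module category to a finite direct sum of suspensions Ω^i L. -/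
open CategoryTheory

namespace StmodGH

variable {A : Type} [Ring A]

/-- A finite dimensional `k`-algebra `A` is symmetric if it carries a `k`-linear form that
is symmetric (`λ(ab) = λ(ba)`) and whose associated bilinear form is nondegenerate. -/
def IsSymmetricAlgebra (k A : Type) [Field k] [Ring A] [Algebra k A] : Prop :=
  ∃ lam : A →ₗ[k] k, (∀ a b : A, lam (a * b) = lam (b * a)) ∧
    ∀ a : A, a ≠ 0 → ∃ b : A, lam (a * b) ≠ 0

section Krull

open Preadditive

variable {C : Type*} [Category* C] [Preadditive C]

/-- An object whose endomorphism ring is zero or local. -/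
def EndLocal (X : C) : Prop := ∀ a : X ⟶ X, IsIso a ∨ IsIso (𝟙 X - a)

lemma EndLocal.of_iso {X Y : C} (e : X ≅ Y) (h : EndLocal X) : EndLocal Y := by
  intro a
  rcases h (e.hom ≫ a ≫ e.inv) with h' | h'
  · left
    have : a = e.inv ≫ (e.hom ≫ a ≫ e.inv) ≫ e.hom := by simp
    rw [this]
    infer_instance
  · right
    have : 𝟙 Y - a = e.inv ≫ (𝟙 X - e.hom ≫ a ≫ e.inv) ≫ e.hom := by simp
    rw [this]
    infer_instance

/-- If `1 - vu` is invertible, then `1 - uv` has a one-sided inverse. -/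
lemma exists_comp_eq_id_of_isIso_swap {X Y : C} (u : X ⟶ Y) (v : Y ⟶ X)
    (h : IsIso (𝟙 Y - v ≫ u)) : ∃ z : X ⟶ X, (𝟙 X - u ≫ v) ≫ z = 𝟙 X := by
  obtain ⟨w, hw, -⟩ := h
  refine ⟨𝟙 X + u ≫ w ≫ v, ?_⟩
  have h2 : w - v ≫ u ≫ w = 𝟙 Y := by simpa [sub_comp] using hw
  have h3 : u ≫ w ≫ v - u ≫ v ≫ u ≫ w ≫ v = u ≫ v := by
    have := congr_arg (fun t => u ≫ t ≫ v) h2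
    simpa [sub_comp, comp_sub] using this
  calc (𝟙 X - u ≫ v) ≫ (𝟙 X + u ≫ w ≫ v)
      = 𝟙 X + (u ≫ w ≫ v - u ≫ v ≫ u ≫ w ≫ v) - u ≫ v := by
        simp only [comp_add, sub_comp, Category.comp_id, Category.id_comp, Category.assoc]
        abel
    _ = 𝟙 X := by rw [h3]; abel

/-- An idempotent all of whose components `f ≫ π j` are radical vanishes. -/
lemma idempotent_eq_zero {S : C} {n : ℕ} {X : Fin n → C} (inc : ∀ j, X j ⟶ S)
    (pr : ∀ j, S ⟶ X j) (hsum : ∑ j, pr j ≫ inc j = 𝟙 S) (f : S ⟶ S) (hf : f ≫ f = f)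
    (hrad : ∀ j (x : X j ⟶ S), IsIso (𝟙 (X j) - x ≫ f ≫ pr j)) : f = 0 := by
  let J : Ideal (End S) := Ideal.jacobson ⊥
  have hJ : ∀ g : S ⟶ S, (g : End S) ∈ J ↔ ∀ y : S ⟶ S, ∃ z : S ⟶ S,
      g ≫ y ≫ z + z - 𝟙 S = 0 := fun g =>
    Ideal.mem_jacobson_iff (R := End S)
  have hmem : ∀ j, (f ≫ pr j ≫ inc j : End S) ∈ J := by
    intro j
    refine (hJ _).2 fun y => ?_
    obtain ⟨z, hz⟩ := exists_comp_eq_id_of_isIso_swap (f ≫ pr j) (-(inc j ≫ y))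
      (by simpa using hrad j (-(inc j ≫ y)))
    refine ⟨z, ?_⟩
    rw [← hz]
    simp only [comp_neg, sub_neg_eq_add, add_comp, Category.id_comp, Category.assoc]
    abel
  have hfJ : (f : End S) ∈ J := by
    have : f = ∑ j, f ≫ pr j ≫ inc j := by rw [← comp_sum, hsum, Category.comp_id]
    rw [this]
    exact J.sum_mem fun j _ => hmem j
  obtain ⟨z, hz⟩ := (hJ f).1 hfJ (-𝟙 S)
  have hz' : (𝟙 S - f) ≫ z = 𝟙 S := by
    rw [← sub_eq_zero, ← hz]
    simp only [sub_comp, neg_comp, comp_neg, Category.id_comp]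
    abel
  calc f = (f ≫ (𝟙 S - f)) ≫ z := by rw [Category.assoc, hz', Category.comp_id]
    _ = 0 := by rw [comp_sub, Category.comp_id, hf, sub_self, Limits.zero_comp]

/-- A retract of a finite direct sum of objects with local endomorphism rings, taken from a
family closed under finite direct sums, is isomorphic to a direct sum of members of that family. -/
lemma exists_iso_of_retract {I : Type*} (N : I → C) (hN : ∀ i, EndLocal (N i))
    (S : ∀ n : ℕ, (Fin n → I) → C)
    (inc : ∀ n (c : Fin n → I) j, N (c j) ⟶ S n c) (pr : ∀ n (c : Fin n → I) j, S n c ⟶ N (c j))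
    (hsum : ∀ n c, ∑ j, pr n c j ≫ inc n c j = 𝟙 (S n c))
    (hid : ∀ n c j, inc n c j ≫ pr n c j = 𝟙 _)
    (hne : ∀ n c j l, j ≠ l → inc n c j ≫ pr n c l = 0)
    (M : C) (hM : ∃ n c, ∃ (s : M ⟶ S n c) (r : S n c ⟶ M), s ≫ r = 𝟙 M) :
    ∃ n c, Nonempty (M ≅ S n c) := by
  classical
  obtain ⟨c, s, r, hsr⟩ := Nat.find_spec hM
  have hmin : ∀ m, m < Nat.find hM → _ := fun m hm => Nat.find_min hM hm
  generalize Nat.find hM = n at c s r hsr hmin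
  refine ⟨n, c, ⟨⟨s, r, hsr, ?_⟩⟩⟩
  suffices h : 𝟙 (S n c) - r ≫ s = 0 from (sub_eq_zero.mp h).symm
  set f := 𝟙 (S n c) - r ≫ s with hfdef
  have hfr : f ≫ r = 0 := by simp [hfdef, hsr]
  have hff : f ≫ f = f := by
    conv_lhs => rhs; rw [hfdef]
    rw [comp_sub, Category.comp_id, reassoc_of% hfr, Limits.zero_comp, sub_zero]
  refine idempotent_eq_zero (inc n c) (pr n c) (hsum n c) f hff fun j x => ?_
  refine (hN (c j) (x ≫ f ≫ pr n c j)).resolve_left fun hu => ?_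
  obtain ⟨w', -, hwx⟩ := hu
  obtain ⟨m, rfl⟩ : ∃ m, n = m + 1 := ⟨n - 1, by have := j.2; omega⟩
  refine hmin m (Nat.lt_succ_self m) ⟨fun l => c (j.succAbove l), ?_⟩
  set s' := s - s ≫ pr _ c j ≫ w' ≫ x ≫ f with hs'
  have hs'r : s' ≫ r = 𝟙 M := by simp [hs', sub_comp, hfr, hsr]
  have hs'p : s' ≫ pr _ c j = 0 := by simp [hs', sub_comp, hwx]
  refine ⟨∑ l, s' ≫ pr _ c (j.succAbove l) ≫ inc m (fun l => c (j.succAbove l)) l,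
    ∑ l, pr m (fun l => c (j.succAbove l)) l ≫ inc _ c (j.succAbove l) ≫ r, ?_⟩
  have hS := hsum _ c
  rw [Fin.sum_univ_succAbove _ j] at hS
  rw [sum_comp]
  have : ∀ l, (s' ≫ pr _ c (j.succAbove l) ≫ inc m (fun l => c (j.succAbove l)) l) ≫
      (∑ l, pr m (fun l => c (j.succAbove l)) l ≫ inc _ c (j.succAbove l) ≫ r)
      = s' ≫ pr _ c (j.succAbove l) ≫ inc _ c (j.succAbove l) ≫ r := by
    intro l
    rw [comp_sum, Finset.sum_eq_single l]
    · have := hid m (fun l => c (j.succAbove l)) l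
      simp [reassoc_of% this]
    · intro b _ hb
      have := hne m (fun l => c (j.succAbove l)) l b hb.symm
      simp [reassoc_of% this]
    · simp
  rw [Finset.sum_congr rfl fun l _ => this l, ← hs'r]
  conv_rhs => rw [← Category.id_comp r, ← hS]
  rw [add_comp, comp_add, Category.assoc, reassoc_of% hs'p, Limits.zero_comp, zero_add, sum_comp,
    comp_sum]
  simp

end Krull

universe v

section Stable

open Preadditive Limits

namespace StablyZero

lemma of_comp_left {M N R : ModuleCat.{v} A} (f : M ⟶ N) {g : N ⟶ R} (hg : StablyZero g) :
    StablyZero (f ≫ g) := by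
  obtain ⟨P, hP, a, b, rfl⟩ := hg
  exact ⟨P, hP, f ≫ a, b, by simp⟩

lemma of_comp_right {M N R : ModuleCat.{v} A} {f : M ⟶ N} (hf : StablyZero f) (g : N ⟶ R) :
    StablyZero (f ≫ g) := by
  obtain ⟨P, hP, a, b, rfl⟩ := hf
  exact ⟨P, hP, a, b ≫ g, by simp⟩

lemma zero (M N : ModuleCat.{v} A) : StablyZero (0 : M ⟶ N) :=
  ⟨ModuleCat.of A PUnit, inferInstance, 0, 0, by simp⟩

lemma add {M N : ModuleCat.{v} A} {f g : M ⟶ N} (hf : StablyZero f) (hg : StablyZero g) :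
    StablyZero (f + g) := by
  obtain ⟨P, hP, a, b, rfl⟩ := hf
  obtain ⟨P', hP', a', b', rfl⟩ := hg
  exact ⟨P ⊞ P', inferInstance, biprod.lift a a', biprod.desc b b', by simp⟩

lemma neg {M N : ModuleCat.{v} A} {f : M ⟶ N} (hf : StablyZero f) : StablyZero (-f) := by
  obtain ⟨P, hP, a, b, rfl⟩ := hf
  exact ⟨P, hP, -a, b, by simp⟩

end StablyZero

variable (A) in
/-- Two maps of modules are related if they agree in the stable module category. -/
def stableRel : HomRel (ModuleCat.{v} A) := fun _ _ f g => StablyZero (f - g)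

instance : Congruence (stableRel.{v} A) where
  equivalence :=
    { refl := fun f => by simpa [stableRel] using StablyZero.zero _ _
      symm := fun {f g} h => by simpa [stableRel] using StablyZero.neg h
      trans := fun {f g h} h₁ h₂ => by simpa [stableRel] using StablyZero.add h₁ h₂ }
  comp_left f _ _ h := by
    simpa [stableRel, comp_sub] using StablyZero.of_comp_left f h
  comp_right g h := by
    simpa [stableRel, sub_comp] using StablyZero.of_comp_right h g

lemma stableRel_add ⦃X Y : ModuleCat.{v} A⦄ (f₁ f₂ g₁ g₂ : X ⟶ Y) (hf : stableRel A f₁ f₂)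
    (hg : stableRel A g₁ g₂) : stableRel A (f₁ + g₁) (f₂ + g₂) := by
  simpa [stableRel, add_sub_add_comm] using StablyZero.add hf hg

variable (A) in
/-- The stable category of all modules. -/
abbrev Stab := Quotient (stableRel.{v} A)

instance : Preadditive (Stab.{v} A) := Quotient.preadditive _ stableRel_add

variable (A) in
/-- The projection to the stable module category. -/
abbrev stab : ModuleCat.{v} A ⥤ Stab.{v} A := Quotient.functor _

instance : (stab.{v} A).Additive := Quotient.functor_additive _ stableRel_add

variable {M N K P M' K' P' : ModuleCat.{v} A}

lemma stab_map_eq_iff (f g : M ⟶ N) : (stab A).map f = (stab A).map g ↔ StablyZero (f - g) :=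
  Quotient.functor_map_eq_iff _ _ _

lemma stab_map_eq_zero_iff (f : M ⟶ N) : (stab A).map f = 0 ↔ StablyZero f := by
  rw [← (stab A).map_zero, stab_map_eq_iff, sub_zero]

lemma stablyIso_iff : StablyIso M N ↔ Nonempty ((stab A).obj M ≅ (stab A).obj N) := by
  constructor
  · rintro ⟨f, g, h₁, h₂⟩
    refine ⟨⟨(stab A).map f, (stab A).map g, ?_, ?_⟩⟩
    · rw [← Functor.map_comp, ← (stab A).map_id, stab_map_eq_iff]
      exact h₁
    · rw [← Functor.map_comp, ← (stab A).map_id, stab_map_eq_iff]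
      exact h₂
  · rintro ⟨e⟩
    obtain ⟨f, hf⟩ := (stab A).map_surjective e.hom
    obtain ⟨g, hg⟩ := (stab A).map_surjective e.inv
    refine ⟨f, g, ?_, ?_⟩
    · rw [← stab_map_eq_iff, Functor.map_comp, hf, hg, e.hom_inv_id, (stab A).map_id]
    · rw [← stab_map_eq_iff, Functor.map_comp, hf, hg, e.inv_hom_id, (stab A).map_id]

namespace SES

lemma mono (s : SES K P M) : Mono s.i := (ModuleCat.mono_iff_injective _).2 s.inj

lemma epi (s : SES K P M) : Epi s.p := (ModuleCat.epi_iff_surjective _).2 s.surj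

lemma i_p (s : SES K P M) : s.i ≫ s.p = 0 := by
  ext x
  exact (s.exact _).2 ⟨x, rfl⟩

lemma shortExact (s : SES K P M) : (ShortComplex.mk s.i s.p s.i_p).ShortExact where
  exact := by
    rw [ShortComplex.moduleCat_exact_iff]
    exact fun x hx => (s.exact x).1 hx
  mono_f := s.mono
  epi_g := s.epi

lemma exists_lift (s : SES K P M) (f : N ⟶ P) (hf : f ≫ s.p = 0) : ∃ g : N ⟶ K, g ≫ s.i = f :=
  have := s.mono
  ⟨s.shortExact.exact.lift f hf, s.shortExact.exact.lift_f f hf⟩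

lemma exists_desc (s : SES K P M) (f : P ⟶ N) (hf : s.i ≫ f = 0) : ∃ g : M ⟶ N, s.p ≫ g = f :=
  have := s.epi
  ⟨s.shortExact.exact.desc f hf, s.shortExact.exact.g_desc f hf⟩

/-- The maps `b` and `a` on the outer terms are part of a map of short exact sequences. -/
def Rel (s : SES K P M) (s' : SES K' P' M') (b : K ⟶ K') (a : M ⟶ M') : Prop :=
  ∃ m : P ⟶ P', s.i ≫ m = b ≫ s'.i ∧ s.p ≫ a = m ≫ s'.p

lemma exists_rel_left (s : SES K P M) (s' : SES K' P' M') (hP : Projective P) (a : M ⟶ M') :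
    ∃ b, Rel s s' b a := by
  have := s'.epi
  have hm := Projective.factorThru_comp (s.p ≫ a) s'.p
  obtain ⟨b, hb⟩ := s'.exists_lift (s.i ≫ Projective.factorThru (s.p ≫ a) s'.p) (by
    rw [Category.assoc, hm, ← Category.assoc, s.i_p, zero_comp])
  exact ⟨b, _, hb.symm, hm.symm⟩

lemma exists_rel_right (s : SES K P M) (s' : SES K' P' M') (hP' : Injective P') (b : K ⟶ K') :
    ∃ a, Rel s s' b a := by
  have := s.mono
  have hm := Injective.comp_factorThru (b ≫ s'.i) s.i
  obtain ⟨a, ha⟩ := s.exists_desc (Injective.factorThru (b ≫ s'.i) s.i ≫ s'.p) (by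
    rw [← Category.assoc, hm, Category.assoc, s'.i_p, comp_zero])
  exact ⟨a, _, hm, ha⟩

lemma Rel.comp {K'' P'' M'' : ModuleCat.{v} A} {s : SES K P M} {s' : SES K' P' M'}
    {s'' : SES K'' P'' M''} {b : K ⟶ K'} {a : M ⟶ M'} {b' : K' ⟶ K''} {a' : M' ⟶ M''}
    (h : Rel s s' b a) (h' : Rel s' s'' b' a') : Rel s s'' (b ≫ b') (a ≫ a') := by
  obtain ⟨m, h₁, h₂⟩ := h
  obtain ⟨m', h₁', h₂'⟩ := h'
  exact ⟨m ≫ m', by rw [reassoc_of% h₁, h₁', Category.assoc],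
    by rw [reassoc_of% h₂, h₂', Category.assoc]⟩

lemma Rel.sub {s : SES K P M} {s' : SES K' P' M'} {b b' : K ⟶ K'} {a a' : M ⟶ M'}
    (h : Rel s s' b a) (h' : Rel s s' b' a') : Rel s s' (b - b') (a - a') := by
  obtain ⟨m, h₁, h₂⟩ := h
  obtain ⟨m', h₁', h₂'⟩ := h'
  exact ⟨m - m', by rw [comp_sub, sub_comp, h₁, h₁'], by rw [comp_sub, sub_comp, h₂, h₂']⟩

lemma rel_id (s : SES K P M) : Rel s s (𝟙 K) (𝟙 M) := ⟨𝟙 P, by simp, by simp⟩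

lemma Rel.stablyZero_iff (hinj : ∀ P : ModuleCat.{v} A, Projective P → Injective P)
    {s : SES K P M} {s' : SES K' P' M'} (hP : Projective P) (hP' : Projective P')
    {b : K ⟶ K'} {a : M ⟶ M'} (h : Rel s s' b a) : StablyZero b ↔ StablyZero a := by
  obtain ⟨m, h₁, h₂⟩ := h
  have := s.mono
  have := s'.mono
  have := s.epi
  have := s'.epi
  constructor
  · rintro ⟨R, hR, g, g', rfl⟩
    have := hinj R hR
    have hw := Injective.comp_factorThru g s.i
    obtain ⟨u, hu⟩ := s.exists_desc (m - Injective.factorThru g s.i ≫ g' ≫ s'.i) (by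
      rw [comp_sub, h₁, reassoc_of% hw, Category.assoc, sub_self])
    refine ⟨P', hP', u, s'.p, ?_⟩
    rw [← cancel_epi s.p, reassoc_of% hu, h₂]
    simp [sub_comp, s'.i_p]
  · rintro ⟨R, hR, g, g', rfl⟩
    have hw := Projective.factorThru_comp g' s'.p
    obtain ⟨w, hw'⟩ := s'.exists_lift (m - s.p ≫ g ≫ Projective.factorThru g' s'.p) (by
      rw [sub_comp, Category.assoc, Category.assoc, hw, h₂, sub_self])
    refine ⟨P, hP, s.i, w, ?_⟩
    rw [← cancel_mono s'.i, Category.assoc, hw', comp_sub, h₁, ← Category.assoc s.i, s.i_p,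
      zero_comp, sub_zero]

lemma Rel.comp_eq_id_iff (hinj : ∀ P : ModuleCat.{v} A, Projective P → Injective P)
    {s : SES K P M} {s' : SES K' P' M'} (hP : Projective P)
    {b : K ⟶ K'} {a : M ⟶ M'} {b' : K' ⟶ K} {a' : M' ⟶ M}
    (h : Rel s s' b a) (h' : Rel s' s b' a') :
    (stab A).map b ≫ (stab A).map b' = 𝟙 _ ↔ (stab A).map a ≫ (stab A).map a' = 𝟙 _ := by
  rw [← Functor.map_comp, ← (stab A).map_id, stab_map_eq_iff, ← Functor.map_comp,
    ← (stab A).map_id, stab_map_eq_iff]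
  exact ((h.comp h').sub s.rel_id).stablyZero_iff hinj hP hP

/-- Schanuel's lemma in the stable category. -/
lemma nonempty_iso_iff (hinj : ∀ P : ModuleCat.{v} A, Projective P → Injective P)
    (s : SES K P M) (s' : SES K' P' M') (hP : Projective P) (hP' : Projective P') :
    Nonempty ((stab A).obj K ≅ (stab A).obj K') ↔
      Nonempty ((stab A).obj M ≅ (stab A).obj M') := by
  constructor
  · rintro ⟨e⟩
    obtain ⟨b, hb⟩ := (stab A).map_surjective e.hom
    obtain ⟨b', hb'⟩ := (stab A).map_surjective e.inv
    obtain ⟨a, ha⟩ := exists_rel_right s s' (hinj _ hP') b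
    obtain ⟨a', ha'⟩ := exists_rel_right s' s (hinj _ hP) b'
    exact ⟨⟨(stab A).map a, (stab A).map a',
      (ha.comp_eq_id_iff hinj hP ha').1 (by rw [hb, hb', e.hom_inv_id]),
      (ha'.comp_eq_id_iff hinj hP' ha).1 (by rw [hb, hb', e.inv_hom_id])⟩⟩
  · rintro ⟨e⟩
    obtain ⟨a, ha⟩ := (stab A).map_surjective e.hom
    obtain ⟨a', ha'⟩ := (stab A).map_surjective e.inv
    obtain ⟨b, hb⟩ := exists_rel_left s s' hP a
    obtain ⟨b', hb'⟩ := exists_rel_left s' s hP' a'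
    exact ⟨⟨(stab A).map b, (stab A).map b',
      (hb.comp_eq_id_iff hinj hP hb').2 (by rw [ha, ha', e.hom_inv_id]),
      (hb'.comp_eq_id_iff hinj hP' hb).2 (by rw [ha, ha', e.inv_hom_id])⟩⟩

lemma Rel.isIso_iff (hinj : ∀ P : ModuleCat.{v} A, Projective P → Injective P)
    {s : SES K P M} (hP : Projective P) {b : K ⟶ K} {a : M ⟶ M} (h : Rel s s b a) :
    IsIso ((stab A).map b) ↔ IsIso ((stab A).map a) := by
  constructor
  · rintro ⟨c, h₁, h₂⟩
    obtain ⟨b', rfl⟩ := (stab A).map_surjective c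
    obtain ⟨a', ha'⟩ := exists_rel_right s s (hinj _ hP) b'
    exact ⟨_, (h.comp_eq_id_iff hinj hP ha').1 h₁, (ha'.comp_eq_id_iff hinj hP h).1 h₂⟩
  · rintro ⟨c, h₁, h₂⟩
    obtain ⟨a', rfl⟩ := (stab A).map_surjective c
    obtain ⟨b', hb'⟩ := exists_rel_left s s hP a'
    exact ⟨_, (h.comp_eq_id_iff hinj hP hb').2 h₁, (hb'.comp_eq_id_iff hinj hP h).2 h₂⟩

lemma endLocal_iff (hinj : ∀ P : ModuleCat.{v} A, Projective P → Injective P)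
    (s : SES K P M) (hP : Projective P) :
    EndLocal ((stab A).obj K) ↔ EndLocal ((stab A).obj M) := by
  have key : ∀ {b : K ⟶ K} {a : M ⟶ M}, Rel s s b a →
      ((IsIso ((stab A).map b) ∨ IsIso (𝟙 _ - (stab A).map b)) ↔
        (IsIso ((stab A).map a) ∨ IsIso (𝟙 _ - (stab A).map a))) := by
    intro b a h
    rw [← (stab A).map_id, ← (stab A).map_id, ← Functor.map_sub, ← Functor.map_sub,
      h.isIso_iff hinj hP, (s.rel_id.sub h).isIso_iff hinj hP]
  constructor
  · intro h c
    obtain ⟨a, rfl⟩ := (stab A).map_surjective c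
    obtain ⟨b, hb⟩ := exists_rel_left s s hP a
    exact (key hb).1 (h _)
  · intro h c
    obtain ⟨b, rfl⟩ := (stab A).map_surjective c
    obtain ⟨a, ha⟩ := exists_rel_right s s (hinj _ hP) b
    exact (key ha).2 (h _)

end SES

end Stable

section Form

variable {k : Type} [Field k] [Algebra k A]

lemma eq_zero_of_form_mul_eq_zero {lam : A →ₗ[k] k} (hs : ∀ a b : A, lam (a * b) = lam (b * a))
    (hnd : ∀ a : A, a ≠ 0 → ∃ b : A, lam (a * b) ≠ 0) {a : A} (h : ∀ c, lam (c * a) = 0) :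
    a = 0 := by
  by_contra ha
  obtain ⟨b, hb⟩ := hnd a ha
  exact hb (by rw [hs, h])

variable [FiniteDimensional k A]

/-- Over a symmetric algebra every `k`-valued functional on a module comes from an `A`-linear map
to `A`. -/
lemma exists_form_comp_eq {lam : A →ₗ[k] k} (hs : ∀ a b : A, lam (a * b) = lam (b * a))
    (hnd : ∀ a : A, a ≠ 0 → ∃ b : A, lam (a * b) ≠ 0)
    {X : Type*} [AddCommGroup X] [Module A X] [Module k X] [IsScalarTower k A X]
    (α : X →ₗ[k] k) : ∃ f : X →ₗ[A] A, ∀ x, lam (f x) = α x := by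
  let T : A →ₗ[k] Module.Dual k A := (LinearMap.mul k A).flip.compr₂ lam
  have hT : ∀ a c, T a c = lam (c * a) := fun a c => rfl
  have hTinj : Function.Injective T := by
    rw [injective_iff_map_eq_zero]
    intro a ha
    by_contra h
    obtain ⟨b, hb⟩ := hnd a h
    exact hb (by rw [hs, ← hT, ha]; rfl)
  let e : A ≃ₗ[k] Module.Dual k A :=
    LinearEquiv.ofInjectiveOfFinrankEq T hTinj (Subspace.dual_finrank_eq).symm
  have he : ∀ a c, e a c = lam (c * a) := fun a c => rfl
  have hes : ∀ β c, lam (c * e.symm β) = β c := fun β c => by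
    rw [← he, LinearEquiv.apply_symm_apply]
  let β : X → Module.Dual k A := fun x => α ∘ₗ (LinearMap.toSpanSingleton A X x).restrictScalars k
  have hβ : ∀ x c, β x c = α (c • x) := fun x c => rfl
  refine ⟨{ toFun := fun x => e.symm (β x), map_add' := ?_, map_smul' := ?_ }, ?_⟩
  · intro x y
    rw [← map_add]
    congr 1
    ext c
    simp [hβ]
  · intro a x
    apply e.injective
    ext c
    rw [LinearEquiv.apply_symm_apply, hβ, RingHom.id_apply, smul_eq_mul, he, ← mul_assoc, hes, hβ,
      mul_smul]
  · intro x
    have := hes (β x) 1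
    simpa [hβ] using this

/-- Free modules over a symmetric algebra are injective. -/
lemma exists_extend_finsupp {lam : A →ₗ[k] k} (hs : ∀ a b : A, lam (a * b) = lam (b * a))
    (hnd : ∀ a : A, a ≠ 0 → ∃ b : A, lam (a * b) ≠ 0)
    {X Y κ : Type*} [AddCommGroup X] [Module A X] [AddCommGroup Y] [Module A Y]
    (i : X →ₗ[A] Y) (hi : Function.Injective i) (f : X →ₗ[A] (κ →₀ A)) :
    ∃ g : Y →ₗ[A] (κ →₀ A), g ∘ₗ i = f := by
  let : Module k X := Module.restrictScalars k A X
  let : Module k Y := Module.restrictScalars k A Y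
  have : IsScalarTower k A X := IsScalarTower.restrictScalars k A X
  have : IsScalarTower k A Y := IsScalarTower.restrictScalars k A Y
  obtain ⟨r, hr⟩ := (i.restrictScalars k).exists_leftInverse_of_injective
    (LinearMap.ker_eq_bot.2 hi)
  have hr' : ∀ x, r (i x) = x := fun x => LinearMap.congr_fun hr x
  let β : Y →ₗ[k] (κ →₀ k) := Finsupp.mapRange.linearMap lam ∘ₗ f.restrictScalars k ∘ₗ r
  have hβ : ∀ x l, β (i x) l = lam (f x l) := fun x l => by simp [β, hr']
  choose F hF using fun l => exists_form_comp_eq hs hnd (Finsupp.lapply l ∘ₗ β)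
  have hF' : ∀ l y c, lam (c * F l y) = β (c • y) l := fun l y c => by
    rw [← smul_eq_mul, ← map_smul, hF]
    rfl
  have hfin : ∀ y, (Function.support fun l => F l y).Finite := by
    intro y
    let b := Module.finBasis k A
    classical
    refine ((Finset.univ.biUnion fun j => (β (b j • y)).support).finite_toSet).subset ?_
    intro l hl
    by_contra hl'
    refine hl (eq_zero_of_form_mul_eq_zero hs hnd fun c => ?_)
    rw [hF']
    have h0 : ∀ j, β (b j • y) l = 0 := by simpa using hl'
    rw [← b.sum_repr c, Finset.sum_smul, map_sum, Finsupp.finsetSum_apply]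
    refine Finset.sum_eq_zero fun j _ => ?_
    rw [smul_assoc, map_smul, Finsupp.smul_apply, h0, smul_zero]
  refine ⟨{ toFun := fun y => Finsupp.ofSupportFinite (fun l => F l y) (hfin y),
            map_add' := ?_, map_smul' := ?_ }, ?_⟩
  · intro y z
    ext l
    simp [Finsupp.ofSupportFinite_coe]
  · intro a y
    ext l
    simp [Finsupp.ofSupportFinite_coe]
  · ext x l
    change F l (i x) = f x l
    rw [← sub_eq_zero]
    refine eq_zero_of_form_mul_eq_zero hs hnd fun c => ?_
    rw [mul_sub, map_sub, hF', ← map_smul, hβ, map_smul, Finsupp.smul_apply, smul_eq_mul, sub_self]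

/-- Projective modules over a symmetric algebra are injective. -/
lemma injective_of_projective (hsym : IsSymmetricAlgebra k A) (P : ModuleCat.{v} A)
    (hP : Projective P) : Injective P := by
  obtain ⟨lam, hs, hnd⟩ := hsym
  refine ⟨fun {X Y} g f hf => ?_⟩
  rw [ModuleCat.mono_iff_injective] at hf
  have : Module.Projective A P := inferInstance
  obtain ⟨s, hs'⟩ := Module.projective_def'.1 this
  obtain ⟨h, hh⟩ := exists_extend_finsupp hs hnd f.hom hf (s ∘ₗ g.hom)
  refine ⟨ModuleCat.ofHom (Finsupp.linearCombination A id ∘ₗ h), ?_⟩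
  ext x
  have h1 := LinearMap.congr_fun hh x
  have h2 := LinearMap.congr_fun hs' (g x)
  simp only [LinearMap.comp_apply] at h1 h2
  change Finsupp.linearCombination A id (h (f.hom x)) = g x
  rw [h1]
  exact h2

/-- Auslander-Reiten duality over a symmetric algebra: a functional `φ` on the endomorphisms of
`M` vanishing on maps which factor through `A` is represented by a map `b` from `M` to the kernel
of a free cover `p`. -/
lemma exists_dual_map (hsym : IsSymmetricAlgebra k A)
    (M : Type v) [AddCommGroup M] [Module A M] [Module.Finite A M] [Module k M]
    [IsScalarTower k A M] (φ : (M →ₗ[A] M) →ₗ[k] k) (hφ₀ : φ ≠ 0)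
    (hφ : ∀ (c : M →ₗ[A] A) (y : M), φ (LinearMap.toSpanSingleton A M y ∘ₗ c) = 0) :
    ∃ (n m : ℕ) (p : (Fin n → A) →ₗ[A] M) (q : (Fin m → A) →ₗ[A] (Fin n → A))
      (b : M →ₗ[A] (Fin n → A)), Function.Surjective p ∧ LinearMap.range q = LinearMap.ker p ∧
      p ∘ₗ b = 0 ∧ (¬ ∃ u : M →ₗ[A] (Fin m → A), b = q ∘ₗ u) ∧
      ∀ (X : Type v) [AddCommGroup X] [Module A X] (g : X →ₗ[A] M),
        (∀ h : M →ₗ[A] X, φ (g ∘ₗ h) = 0) → ∃ e : X →ₗ[A] (Fin m → A), b ∘ₗ g = q ∘ₗ e := by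
  obtain ⟨lam, hs, hnd⟩ := hsym
  have : IsNoetherianRing A := isNoetherian_of_tower k inferInstance
  obtain ⟨n, p, hp⟩ := Module.Finite.exists_fin' A M
  obtain ⟨m, q', hq'⟩ := Module.Finite.exists_fin' A (LinearMap.ker p)
  let q := (LinearMap.ker p).subtype ∘ₗ q'
  have hq : LinearMap.range q = LinearMap.ker p := by
    rw [LinearMap.range_comp, LinearMap.range_eq_top.2 hq', Submodule.map_top,
      Submodule.range_subtype]
  let μ : Fin n → M := fun j => p (Pi.single j 1)
  have hsingle : ∀ {l : ℕ} (x : Fin l → A), x = ∑ j, x j • Pi.single j 1 := fun x => by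
    conv_lhs => rw [← Finset.univ_sum_single x]
    exact Finset.sum_congr rfl fun j _ => by rw [← Pi.single_smul, smul_eq_mul, mul_one]
  have hμ : ∀ x, p x = ∑ j, x j • μ j := fun x => by
    conv_lhs => rw [hsingle x, map_sum]
    simp only [map_smul, μ]
  let κ : Fin m → Fin n → A := fun t => q (Pi.single t 1)
  have hκ : ∀ x j, q x j = ∑ t, x t * κ t j := fun x j => by
    conv_lhs => rw [hsingle x, map_sum, Finset.sum_apply]
    simp only [map_smul, κ, Pi.smul_apply, smul_eq_mul]
  have hκμ : ∀ t, ∑ j, κ t j • μ j = 0 := fun t => by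
    rw [← hμ]
    have : κ t ∈ LinearMap.ker p := hq ▸ LinearMap.mem_range_self _ _
    exact this
  let ev : (M →ₗ[A] M) →ₗ[k] (Fin n → M) :=
    { toFun := fun h j => h (μ j), map_add' := fun _ _ => rfl, map_smul' := fun _ _ => rfl }
  have hev : LinearMap.ker ev = ⊥ := by
    rw [LinearMap.ker_eq_bot']
    intro h hh
    ext y
    obtain ⟨x, rfl⟩ := hp y
    rw [hμ, map_sum, LinearMap.zero_apply]
    refine Finset.sum_eq_zero fun j _ => ?_
    rw [map_smul, show h (μ j) = 0 from congr_fun hh j, smul_zero]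
  obtain ⟨r, hr⟩ := ev.exists_leftInverse_of_injective hev
  choose b hb using fun j => exists_form_comp_eq hs hnd (φ ∘ₗ r ∘ₗ LinearMap.single k _ j)
  have hbφ : ∀ h, φ h = ∑ j, lam (b j (h (μ j))) := by
    intro h
    simp only [hb, LinearMap.comp_apply, ← map_sum]
    have : ∑ j, LinearMap.single k (fun _ => M) j (h (μ j)) = ev h :=
      Finset.univ_sum_single (ev h)
    rw [this]
    exact congr_arg φ (LinearMap.congr_fun hr h).symm
  refine ⟨n, m, p, q, LinearMap.pi b, hp, hq, ?_, ?_, ?_⟩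
  · ext x
    rw [LinearMap.comp_apply, LinearMap.zero_apply]
    by_contra hx
    obtain ⟨α, hα⟩ : ∃ α : Module.Dual k M, α (p (LinearMap.pi b x)) ≠ 0 := by
      by_contra! h
      exact hx ((Module.forall_dual_apply_eq_zero_iff k _).1 h)
    obtain ⟨c, hc⟩ := exists_form_comp_eq hs hnd α
    refine hα ?_
    rw [← hφ c x, ← hc, hμ, map_sum, map_sum, hbφ]
    refine Finset.sum_congr rfl fun j _ => ?_
    simp [hs _ (c (μ j))]
  · rintro ⟨u, hu⟩
    refine hφ₀ (LinearMap.ext fun h => ?_)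
    have hbu : ∀ j x, b j x = ∑ t, u x t * κ t j := fun j x => by
      rw [← hκ]
      exact congr_fun (LinearMap.congr_fun hu x) j
    simp only [hbφ, hbu, map_sum, LinearMap.zero_apply]
    rw [Finset.sum_comm]
    refine Finset.sum_eq_zero fun t _ => ?_
    have : ∑ j, κ t j * u (h (μ j)) t = 0 := by
      have h1 := congr_arg (fun y => u (h y) t) (hκμ t)
      simpa [map_sum, Finset.sum_apply] using h1
    rw [← map_zero lam, ← this, map_sum]
    exact Finset.sum_congr rfl fun j _ => hs _ _
  · intro X _ _ g hg
    let : Module k X := Module.restrictScalars k A X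
    have : IsScalarTower k A X := IsScalarTower.restrictScalars k A X
    let D : (Fin n → X) →ₗ[k] (Fin m → X) :=
      { toFun := fun (x : Fin n → X) t => ∑ j, κ t j • x j
        map_add' := fun x y => by ext t; simp [Finset.sum_add_distrib]
        map_smul' := fun a x => by
          ext t
          simp [Finset.smul_sum, smul_comm _ a] }
    let Ψ : (Fin n → X) →ₗ[k] k :=
      ∑ j, lam ∘ₗ (b j ∘ₗ g).restrictScalars k ∘ₗ LinearMap.proj j
    have hΨ : ∀ x, Ψ x = ∑ j, lam (b j (g (x j))) := fun x => by simp [Ψ]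
    have hΨD : Ψ ∈ LinearMap.range D.dualMap := by
      rw [LinearMap.range_dualMap_eq_dualAnnihilator_ker, Submodule.mem_dualAnnihilator]
      intro x hx
      have hker : LinearMap.ker p ≤ LinearMap.ker (Fintype.linearCombination A x) := by
        rw [← hq, LinearMap.range_le_ker_iff]
        refine LinearMap.pi_ext' fun t => LinearMap.ext_ring ?_
        have : ∑ j, κ t j • x j = 0 := congr_fun (LinearMap.mem_ker.1 hx) t
        simpa [Fintype.linearCombination_apply] using this
      let h : M →ₗ[A] X := (LinearMap.ker p).liftQ _ hker ∘ₗ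
        (p.quotKerEquivOfSurjective hp).symm.toLinearMap
      have hh : ∀ j, h (μ j) = x j := by
        intro j
        have : (p.quotKerEquivOfSurjective hp).symm (μ j)
            = Submodule.Quotient.mk (Pi.single j 1) := by
          rw [LinearEquiv.symm_apply_eq]
          rfl
        simp [h, this]
      rw [hΨ, ← hg h, hbφ]
      simp [hh]
    obtain ⟨Ψ', hΨ'⟩ := hΨD
    choose e he using fun t => exists_form_comp_eq hs hnd (Ψ' ∘ₗ LinearMap.single k _ t)
    have hsum : ∀ x : Fin n → X, ∑ j, lam (b j (g (x j))) = ∑ t, lam (e t (∑ j, κ t j • x j)) := by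
      intro x
      rw [← hΨ, ← hΨ']
      simp only [he, LinearMap.comp_apply, ← map_sum]
      exact congr_arg Ψ' (Finset.univ_sum_single (D x)).symm
    refine ⟨LinearMap.pi e, LinearMap.ext fun x => funext fun j => ?_⟩
    rw [LinearMap.comp_apply, LinearMap.comp_apply, hκ, ← sub_eq_zero]
    refine eq_zero_of_form_mul_eq_zero hs hnd fun c => ?_
    have h1 := hsum (Pi.single j (c • x))
    have h2 : ∀ i, lam (b i (g ((Pi.single j (c • x) : Fin n → X) i))) =
        if i = j then lam (c * b j (g x)) else 0 := by
      intro i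
      by_cases hij : i = j
      · subst hij; simp
      · simp [hij]
    have h3 : ∀ t, ∑ i, κ t i • (Pi.single j (c • x) : Fin n → X) i = (κ t j * c) • x := by
      intro t
      rw [Finset.sum_eq_single j]
      · simp [mul_smul]
      · intro i _ hij; simp [hij]
      · simp
    simp only [h2, h3, Finset.sum_ite_eq', Finset.mem_univ, if_true] at h1
    rw [mul_sub, map_sub, sub_eq_zero]
    refine h1.trans ?_
    rw [Finset.mul_sum, map_sum]
    refine Finset.sum_congr rfl fun t _ => ?_
    rw [map_smul, smul_eq_mul, mul_assoc, hs, mul_assoc]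
    rfl

end Form

section Constructions

open Preadditive Limits

variable {X Y Z X' Z' K P Q M N : ModuleCat.{v} A}

namespace SES

/-- The short exact sequence of a monomorphism and its cokernel. -/
def ofInjective (f : X ⟶ Y) (hf : Function.Injective f) :
    SES X Y (ModuleCat.of A (Y ⧸ LinearMap.range f.hom)) where
  i := f
  p := ModuleCat.ofHom (Submodule.mkQ _)
  inj := hf
  surj := Submodule.mkQ_surjective _
  exact _ := Submodule.Quotient.mk_eq_zero _

/-- The short exact sequence of an epimorphism and its kernel. -/
def ofSurjective (f : Y ⟶ Z) (hf : Function.Surjective f) :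
    SES (ModuleCat.of A (LinearMap.ker f.hom)) Y Z where
  i := ModuleCat.ofHom (Submodule.subtype _)
  p := f
  inj := Submodule.subtype_injective _
  surj := hf
  exact y := ⟨fun h => ⟨⟨y, h⟩, rfl⟩, by rintro ⟨x, rfl⟩; exact x.2⟩

lemma p_i_apply (s : SES X Y Z) (x : X) : s.p (s.i x) = 0 := (s.exact _).2 ⟨x, rfl⟩

lemma exists_pullback (s : SES X Y Z) (s' : SES K Z' Z) :
    ∃ E : ModuleCat.{v} A, Nonempty (SES X E Z') ∧ Nonempty (SES K E Y) := by
  let d : ModuleCat.of A (Y × Z') ⟶ Z :=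
    ModuleCat.ofHom (s.p.hom.coprod (-s'.p.hom))
  have hd : ∀ y z, d (y, z) = s.p y - s'.p z := fun y z => by
    simp [d, sub_eq_add_neg]
  let E := LinearMap.ker d.hom
  have hE : ∀ y z, (y, z) ∈ E ↔ s.p y = s'.p z := fun y z => by
    rw [← sub_eq_zero, ← hd]
    rfl
  refine ⟨ModuleCat.of A E, ⟨⟨ModuleCat.ofHom ((LinearMap.prod s.i.hom 0).codRestrict E
      fun x => (hE _ _).2 (by simpa using s.p_i_apply x)),
      ModuleCat.ofHom (LinearMap.snd A Y Z' ∘ₗ E.subtype), ?_, ?_, ?_⟩⟩,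
    ⟨⟨ModuleCat.ofHom ((LinearMap.prod 0 s'.i.hom).codRestrict E
      fun x => (hE _ _).2 (by simpa using (s'.p_i_apply x).symm)),
      ModuleCat.ofHom (LinearMap.fst A Y Z' ∘ₗ E.subtype), ?_, ?_, ?_⟩⟩⟩
  · exact fun x x' h => s.inj (congr_arg (fun e : E => e.1.1) h)
  · intro z
    obtain ⟨y, hy⟩ := s.surj (s'.p z)
    exact ⟨⟨(y, z), (hE _ _).2 hy⟩, rfl⟩
  · rintro ⟨⟨y, z⟩, h⟩
    constructor
    · rintro (rfl : z = 0)
      obtain ⟨x, rfl⟩ := (s.exact y).1 (by simpa using (hE _ _).1 h)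
      exact ⟨x, rfl⟩
    · rintro ⟨x, hx⟩
      exact (congr_arg (fun e : E => e.1.2) hx).symm
  · exact fun x x' h => s'.inj (congr_arg (fun e : E => e.1.2) h)
  · intro y
    obtain ⟨z, hz⟩ := s'.surj (s.p y)
    exact ⟨⟨(y, z), (hE _ _).2 hz.symm⟩, rfl⟩
  · rintro ⟨⟨y, z⟩, h⟩
    constructor
    · rintro (rfl : y = 0)
      obtain ⟨x, rfl⟩ := (s'.exact z).1 (by simpa using ((hE _ _).1 h).symm)
      exact ⟨x, rfl⟩
    · rintro ⟨x, hx⟩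
      exact (congr_arg (fun e : E => e.1.1) hx).symm

lemma exists_quotient (s : SES X Y Z) (s' : SES P X X') :
    ∃ E : ModuleCat.{v} A, Nonempty (SES X' E Z) ∧ Nonempty (SES P Y E) := by
  let t := ofInjective (s'.i ≫ s.i) (s.inj.comp s'.inj)
  obtain ⟨j, hj⟩ := s'.exists_desc (s.i ≫ t.p) (by rw [← Category.assoc]; exact t.i_p)
  obtain ⟨q, hq⟩ := t.exists_desc s.p (by
    change (s'.i ≫ s.i) ≫ s.p = 0
    rw [Category.assoc, s.i_p, comp_zero])
  have hj' : ∀ x, j (s'.p x) = t.p (s.i x) := fun x => ConcreteCategory.congr_hom hj x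
  have hq' : ∀ y, q (t.p y) = s.p y := fun x => ConcreteCategory.congr_hom hq x
  refine ⟨_, ⟨⟨j, q, ?_, ?_, ?_⟩⟩, ⟨t⟩⟩
  · rw [injective_iff_map_eq_zero]
    intro x' hx'
    obtain ⟨x, rfl⟩ := s'.surj x'
    rw [hj'] at hx'
    obtain ⟨w, hw⟩ := (t.exact _).1 hx'
    have : s'.i w = x := s.inj hw
    rw [← this, s'.p_i_apply]
  · intro z
    obtain ⟨y, rfl⟩ := s.surj z
    exact ⟨_, hq' y⟩
  · intro e
    obtain ⟨y, rfl⟩ := t.surj e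
    rw [hq', s.exact]
    constructor
    · rintro ⟨x, rfl⟩
      exact ⟨_, hj' x⟩
    · rintro ⟨x', hx'⟩
      obtain ⟨x, rfl⟩ := s'.surj x'
      rw [hj', ← sub_eq_zero, ← map_sub, t.exact] at hx'
      obtain ⟨w, hw⟩ := hx'
      refine ⟨x - s'.i w, ?_⟩
      rw [map_sub]
      change s.i x - (s'.i ≫ s.i) w = y
      rw [show (s'.i ≫ s.i) w = s.i x - y from hw, sub_sub_cancel]

lemma exists_sub (s : SES X Y Z) (s' : SES Z' Z P) :
    ∃ E : ModuleCat.{v} A, Nonempty (SES X E Z') ∧ Nonempty (SES E Y P) := by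
  let t := ofSurjective (s.p ≫ s'.p) (s'.surj.comp s.surj)
  obtain ⟨j, hj⟩ := t.exists_lift s.i (by
    change s.i ≫ s.p ≫ s'.p = 0
    rw [← Category.assoc, s.i_p, zero_comp])
  obtain ⟨q, hq⟩ := s'.exists_lift (t.i ≫ s.p) (by rw [Category.assoc]; exact t.i_p)
  have hj' : ∀ x, t.i (j x) = s.i x := fun x => ConcreteCategory.congr_hom hj x
  have hq' : ∀ y, s'.i (q y) = s.p (t.i y) := fun x => ConcreteCategory.congr_hom hq x
  refine ⟨_, ⟨⟨j, q, ?_, ?_, ?_⟩⟩, ⟨t⟩⟩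
  · intro x x' h
    apply s.inj
    rw [← hj', h, hj']
  · intro z
    obtain ⟨y, hy⟩ := s.surj (s'.i z)
    obtain ⟨e, rfl⟩ := (t.exact y).1 (by
      change s'.p (s.p y) = 0
      rw [hy, s'.p_i_apply])
    exact ⟨e, s'.inj (by rw [hq', hy])⟩
  · intro e
    rw [← map_eq_zero_iff s'.i.hom s'.inj]
    change s'.i (q e) = 0 ↔ _
    rw [hq', s.exact]
    exact exists_congr fun x => by rw [← hj', t.inj.eq_iff]

lemma exists_pushout (s : SES X Y Z) (s' : SES X X' Q) :
    ∃ E : ModuleCat.{v} A, Nonempty (SES X' E Z) ∧ Nonempty (SES Y E Q) := by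
  let d : X ⟶ ModuleCat.of A (Y × X') := ModuleCat.ofHom (LinearMap.prod s.i.hom s'.i.hom)
  let t := ofInjective d fun x x' h => s.inj (congr_arg Prod.fst h)
  obtain ⟨q, hq⟩ := t.exists_desc (ModuleCat.ofHom (s.p.hom ∘ₗ LinearMap.fst A Y X')) (by
    ext x; exact s.p_i_apply x)
  obtain ⟨q', hq'⟩ := t.exists_desc (ModuleCat.ofHom (s'.p.hom ∘ₗ LinearMap.snd A Y X')) (by
    ext x; exact s'.p_i_apply x)
  have h₁ : ∀ y x, q (t.p (y, x)) = s.p y := fun y x => ConcreteCategory.congr_hom hq (y, x)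
  have h₂ : ∀ y x, q' (t.p (y, x)) = s'.p x := fun y x => ConcreteCategory.congr_hom hq' (y, x)
  have ht : ∀ y x, t.p (y, x) = 0 ↔ ∃ w, s.i w = y ∧ s'.i w = x := fun y x => by
    rw [t.exact]
    exact exists_congr fun w => Prod.ext_iff
  have hsub : ∀ y x y' x', t.p (y, x) = t.p (y', x') ↔ t.p (y - y', x - x') = 0 :=
    fun y x y' x' => by
      rw [← sub_eq_zero, ← map_sub]
      rfl
  refine ⟨_, ⟨⟨ModuleCat.ofHom (t.p.hom ∘ₗ LinearMap.inr A Y X'), q, ?_, ?_, ?_⟩⟩,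
    ⟨⟨ModuleCat.ofHom (t.p.hom ∘ₗ LinearMap.inl A Y X'), q', ?_, ?_, ?_⟩⟩⟩
  · intro x x' h
    have h : t.p (0, x) = t.p (0, x') := h
    rw [hsub, ht] at h
    obtain ⟨w, hw, hw'⟩ := h
    have : w = 0 := s.inj (by rw [hw, map_zero, sub_zero])
    rwa [this, map_zero, eq_comm, sub_eq_zero] at hw'
  · intro z
    obtain ⟨y, rfl⟩ := s.surj z
    exact ⟨_, h₁ y 0⟩
  · intro e
    obtain ⟨⟨y, x⟩, rfl⟩ := t.surj e
    rw [h₁, s.exact]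
    change _ ↔ ∃ x', t.p (0, x') = t.p (y, x)
    constructor
    · rintro ⟨w, rfl⟩
      exact ⟨x - s'.i w, (hsub _ _ _ _).2 ((ht _ _).2 ⟨-w, by simp, by simp⟩)⟩
    · rintro ⟨x', hx'⟩
      rw [hsub, ht] at hx'
      obtain ⟨w, hw, -⟩ := hx'
      exact ⟨-w, by rw [map_neg, hw, zero_sub, neg_neg]⟩
  · intro x x' h
    have h : t.p (x, 0) = t.p (x', 0) := h
    rw [hsub, ht] at h
    obtain ⟨w, hw, hw'⟩ := h
    have : w = 0 := s'.inj (by rw [hw', map_zero, sub_zero])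
    rwa [this, map_zero, eq_comm, sub_eq_zero] at hw
  · intro z
    obtain ⟨y, rfl⟩ := s'.surj z
    exact ⟨_, h₂ 0 y⟩
  · intro e
    obtain ⟨⟨y, x⟩, rfl⟩ := t.surj e
    rw [h₂, s'.exact]
    change _ ↔ ∃ x', t.p (x', 0) = t.p (y, x)
    constructor
    · rintro ⟨w, rfl⟩
      exact ⟨y - s.i w, (hsub _ _ _ _).2 ((ht _ _).2 ⟨-w, by simp, by simp⟩)⟩
    · rintro ⟨x', hx'⟩
      rw [hsub, ht] at hx'
      obtain ⟨w, -, hw⟩ := hx'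
      exact ⟨-w, by rw [map_neg, hw, zero_sub, neg_neg]⟩

/-- A quotient by a projective submodule does not change the stable isomorphism type. -/
lemma nonempty_iso_of_left (hinj : ∀ P : ModuleCat.{v} A, Projective P → Injective P)
    (s : SES P Y Z) (hP : Projective P) : Nonempty ((stab A).obj Y ≅ (stab A).obj Z) := by
  have := hinj P hP
  have := s.mono
  have := s.epi
  have hr := Injective.comp_factorThru (𝟙 P) s.i
  set r := Injective.factorThru (𝟙 P) s.i
  obtain ⟨g, hg⟩ := s.exists_desc (𝟙 Y - r ≫ s.i) (by
    rw [comp_sub, reassoc_of% hr, Category.comp_id, sub_self])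
  rw [← stablyIso_iff]
  refine ⟨s.p, g, ?_, ?_⟩
  · rw [hg]
    exact ⟨P, hP, -r, s.i, by simp⟩
  · have : g ≫ s.p = 𝟙 Z := by
      rw [← cancel_epi s.p, reassoc_of% hg, sub_comp, Category.assoc, s.i_p]
      simp
    rw [this, sub_self]
    exact StablyZero.zero _ _

/-- A submodule with projective quotient has the same stable isomorphism type. -/
lemma nonempty_iso_of_right (s : SES X Y P) (hP : Projective P) :
    Nonempty ((stab A).obj X ≅ (stab A).obj Y) := by
  have := s.mono
  have := s.epi
  have hr := Projective.factorThru_comp (𝟙 P) s.p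
  set r := Projective.factorThru (𝟙 P) s.p
  obtain ⟨g, hg⟩ := s.exists_lift (𝟙 Y - s.p ≫ r) (by
    rw [sub_comp, Category.assoc, hr, Category.comp_id, Category.id_comp, sub_self])
  rw [← stablyIso_iff]
  refine ⟨s.i, g, ?_, ?_⟩
  · have : s.i ≫ g = 𝟙 X := by
      rw [← cancel_mono s.i, Category.assoc, hg, comp_sub, ← Category.assoc, s.i_p]
      simp
    rw [this, sub_self]
    exact StablyZero.zero _ _
  · rw [hg]
    exact ⟨P, hP, -s.p, r, by simp⟩

end SES

lemma projective_of_stablyZero_id (h : StablyZero (𝟙 M)) : Projective M := by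
  obtain ⟨P, hP, f, g, h⟩ := h
  exact Retract.projective ⟨f, g, h.symm⟩

/-- Stably isomorphic modules become isomorphic after adding projective summands. -/
lemma StablyIso.exists_ses (h : StablyIso M N) :
    ∃ P Q E : ModuleCat.{v} A, Projective P ∧ Projective Q ∧ Nonempty (SES M E Q) ∧
      Nonempty (SES P E N) := by
  obtain ⟨f, g, ⟨P, hP, u, v, huv⟩, h₂⟩ := h
  let m : M ⟶ N ⊞ P := biprod.lift f (-u)
  let r : N ⊞ P ⟶ M := biprod.desc g v
  have hmr : m ≫ r = 𝟙 M := by simp [m, r, ← huv]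
  have hm : Function.Injective m := by
    rw [← ModuleCat.mono_iff_injective]
    exact mono_of_mono_fac hmr
  let s := SES.ofInjective m hm
  have hfst : Function.Surjective (biprod.fst : N ⊞ P ⟶ N) := by
    rw [← ModuleCat.epi_iff_surjective]
    infer_instance
  refine ⟨P, _, N ⊞ P, hP, ?_, ⟨s⟩, ?_⟩
  · have := s.epi
    obtain ⟨σ, hσ⟩ := s.exists_desc (𝟙 _ - r ≫ m) (by
      change m ≫ _ = 0
      rw [comp_sub, reassoc_of% hmr, Category.comp_id, sub_self])
    have hσ' : σ ≫ s.p = 𝟙 _ := by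
      have h0 : m ≫ s.p = 0 := s.i_p
      rw [← cancel_epi s.p, reassoc_of% hσ, sub_comp, Category.assoc, h0]
      simp
    apply projective_of_stablyZero_id
    have h3 : StablyZero (𝟙 (N ⊞ P) - r ≫ m) := by
      have e : 𝟙 (N ⊞ P) - r ≫ m = - (biprod.fst ≫ (g ≫ f - 𝟙 N) ≫ biprod.inl)
          + biprod.fst ≫ g ≫ u ≫ biprod.inr
          + biprod.snd ≫ (biprod.inr - v ≫ m) := by
        apply biprod.hom_ext' <;> apply biprod.hom_ext <;> simp [m, r]
      rw [e]
      exact ((StablyZero.of_comp_left _ (h₂.of_comp_right _)).neg.add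
        ⟨P, hP, biprod.fst ≫ g ≫ u, biprod.inr, by simp⟩).add ⟨P, hP, _, _, rfl⟩
    have := StablyZero.of_comp_left σ (h3.of_comp_right s.p)
    rw [← hσ] at this
    rwa [Category.assoc, hσ', reassoc_of% hσ'] at this
  · refine ⟨⟨biprod.inr, biprod.fst, ?_, hfst, ?_⟩⟩
    · rw [← ModuleCat.mono_iff_injective]
      infer_instance
    · intro y
      constructor
      · intro hy
        refine ⟨(biprod.snd : N ⊞ P ⟶ P) y, ?_⟩
        have h0 : (biprod.snd : N ⊞ P ⟶ P) ≫ biprod.inr = 𝟙 _ - biprod.fst ≫ biprod.inl := by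
          rw [← biprod.total, add_sub_cancel_left]
        refine (ConcreteCategory.congr_hom h0 y).trans ?_
        change y - (biprod.inl : N ⟶ N ⊞ P) ((biprod.fst : N ⊞ P ⟶ N) y) = y
        rw [hy, map_zero, sub_zero]
      · rintro ⟨x, rfl⟩
        exact ConcreteCategory.congr_hom (biprod.inr_fst (X := N) (Y := P)) x

/-- A module is stably finite if it is stably isomorphic to a finitely generated module. -/
def StablyFinite (M : ModuleCat.{v} A) : Prop :=
  ∃ M' : ModuleCat.{v} A, Module.Finite A M' ∧ Nonempty ((stab A).obj M ≅ (stab A).obj M')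

/-- Stably finite modules are closed under extensions. -/
lemma StablyFinite.of_ses (hinj : ∀ P : ModuleCat.{v} A, Projective P → Injective P)
    (s : SES X Y Z) (hX : StablyFinite X) (hZ : StablyFinite Z) : StablyFinite Y := by
  obtain ⟨X', hX', eX⟩ := hX
  obtain ⟨Z', hZ', eZ⟩ := hZ
  obtain ⟨P, Q, E, hP, hQ, ⟨t₁⟩, ⟨t₂⟩⟩ := (stablyIso_iff.2 eX).exists_ses
  obtain ⟨P', Q', F, hP', hQ', ⟨t₃⟩, ⟨t₄⟩⟩ :=
    (stablyIso_iff.2 (eZ.map Iso.symm)).exists_ses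
  obtain ⟨E₁, ⟨s₁⟩, ⟨u₁⟩⟩ := s.exists_pushout t₁
  obtain ⟨E₂, ⟨s₂⟩, ⟨u₂⟩⟩ := s₁.exists_quotient t₂
  obtain ⟨E₃, ⟨s₃⟩, ⟨u₃⟩⟩ := s₂.exists_pullback t₄
  obtain ⟨E₄, ⟨s₄⟩, ⟨u₄⟩⟩ := s₃.exists_sub t₃
  obtain ⟨e₁⟩ := u₁.nonempty_iso_of_right hQ
  obtain ⟨e₂⟩ := u₂.nonempty_iso_of_left hinj hP
  obtain ⟨e₃⟩ := u₃.nonempty_iso_of_left hinj hP'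
  obtain ⟨e₄⟩ := u₄.nonempty_iso_of_right hQ'
  refine ⟨E₄, ?_, ⟨e₁ ≪≫ e₂ ≪≫ e₃.symm ≪≫ e₄.symm⟩⟩
  exact Module.Finite.of_exact (f := s₄.i.hom) (g := s₄.p.hom) s₄.exact s₄.surj

end Constructions

section Sums

open Preadditive Limits

variable {X Y Z K P Q M N : ModuleCat.{v} A} {Ω : ℤ → ModuleCat.{v} A}

lemma projective_pi {n : ℕ} (P : Fin n → ModuleCat.{v} A) (hP : ∀ j, Projective (P j)) :
    Projective (ModuleCat.of A (∀ j, P j)) := by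
  have : ∀ j, Module.Projective A (P j) := fun j => inferInstance
  have : Module.Projective A (∀ j, P j) :=
    Module.Projective.of_equiv' (DFinsupp.linearEquivFunOnFintype (R := A) (M := fun j => P j))
  infer_instance

/-- A finite product of short exact sequences. -/
def SES.pi {n : ℕ} {K P M : Fin n → ModuleCat.{v} A} (s : ∀ j, SES (K j) (P j) (M j)) :
    SES (ModuleCat.of A (∀ j, K j)) (ModuleCat.of A (∀ j, P j)) (ModuleCat.of A (∀ j, M j)) where
  i := ModuleCat.ofHom (LinearMap.piMap fun j => (s j).i.hom)
  p := ModuleCat.ofHom (LinearMap.piMap fun j => (s j).p.hom)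
  inj := Function.Injective.piMap fun j => (s j).inj
  surj := Function.Surjective.piMap fun j => (s j).surj
  exact y := by
    refine funext_iff.trans ((forall_congr' fun j => (s j).exact (y j)).trans ?_)
    refine Classical.skolem.trans (exists_congr fun x => ?_)
    exact funext_iff.symm

variable (Ω) in
/-- A finite direct sum of members of the family `Ω`. -/
abbrev finSum (n : ℕ) (c : Fin n → ℤ) : ModuleCat.{v} A := ModuleCat.of A (∀ j, Ω (c j))

variable (Ω) in
/-- The modules which are stably isomorphic to a finite direct sum of members of `Ω`. -/
def IsSum (M : ModuleCat.{v} A) : Prop :=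
  ∃ (n : ℕ) (c : Fin n → ℤ), Nonempty ((stab A).obj M ≅ (stab A).obj (finSum Ω n c))

lemma IsSum.of_iso (h : IsSum Ω M) (e : Nonempty ((stab A).obj N ≅ (stab A).obj M)) :
    IsSum Ω N := by
  obtain ⟨n, c, ⟨e'⟩⟩ := h
  exact ⟨n, c, e.map fun e => e ≪≫ e'⟩

lemma stablyFinite_finSum (hfin : ∀ i, Module.Finite A (Ω i)) (n : ℕ) (c : Fin n → ℤ) :
    StablyFinite (finSum Ω n c) :=
  ⟨_, Module.Finite.pi, ⟨Iso.refl _⟩⟩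

lemma StablyFinite.of_iso (h : StablyFinite M) (e : Nonempty ((stab A).obj N ≅ (stab A).obj M)) :
    StablyFinite N := by
  obtain ⟨M', hM', ⟨e'⟩⟩ := h
  exact ⟨M', hM', e.map fun e => e ≪≫ e'⟩

lemma IsSum.stablyFinite (hfin : ∀ i, Module.Finite A (Ω i)) (h : IsSum Ω M) :
    StablyFinite M := by
  obtain ⟨n, c, e⟩ := h
  exact (stablyFinite_finSum hfin n c).of_iso e

lemma exists_ses_finSum (hΩ : ∀ i : ℤ, ∃ P, Projective P ∧ Nonempty (SES (Ω (i + 1)) P (Ω i)))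
    (n : ℕ) (c : Fin n → ℤ) :
    ∃ P, Projective P ∧ Nonempty (SES (finSum Ω n fun j => c j + 1) P (finSum Ω n c)) := by
  choose P hP s using fun j => hΩ (c j)
  exact ⟨_, projective_pi P hP, ⟨SES.pi fun j => (s j).some⟩⟩

lemma SES.stablyFinite_right (hinj : ∀ P : ModuleCat.{v} A, Projective P → Injective P)
    (hfin : ∀ i, Module.Finite A (Ω i))
    (hΩ : ∀ i : ℤ, ∃ P, Projective P ∧ Nonempty (SES (Ω (i + 1)) P (Ω i)))
    (s : SES X Y Z) (hX : IsSum Ω X) (hY : StablyFinite Y) : StablyFinite Z := by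
  obtain ⟨n, c, eX⟩ := hX
  obtain ⟨P, Q, E, hP, hQ, ⟨t₁⟩, ⟨t₂⟩⟩ := (stablyIso_iff.2 eX).exists_ses
  obtain ⟨E₁, ⟨s₁⟩, ⟨u₁⟩⟩ := s.exists_pushout t₁
  obtain ⟨E₂, ⟨s₂⟩, ⟨u₂⟩⟩ := s₁.exists_quotient t₂
  obtain ⟨e₁⟩ := u₁.nonempty_iso_of_right hQ
  obtain ⟨e₂⟩ := u₂.nonempty_iso_of_left hinj hP
  obtain ⟨R, hR, ⟨t₃⟩⟩ := exists_ses_finSum hΩ n fun j => c j - 1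
  simp only [sub_add_cancel] at t₃
  obtain ⟨F, ⟨s₃⟩, ⟨u₃⟩⟩ := s₂.exists_pushout t₃
  obtain ⟨e₃⟩ := s₃.nonempty_iso_of_left hinj hR
  have hE₂ : StablyFinite E₂ := hY.of_iso ⟨e₂.symm ≪≫ e₁.symm⟩
  exact (StablyFinite.of_ses hinj u₃ hE₂ (stablyFinite_finSum hfin n _)).of_iso ⟨e₃.symm⟩

lemma SES.stablyFinite_left (hinj : ∀ P : ModuleCat.{v} A, Projective P → Injective P)
    (hfin : ∀ i, Module.Finite A (Ω i))
    (hΩ : ∀ i : ℤ, ∃ P, Projective P ∧ Nonempty (SES (Ω (i + 1)) P (Ω i)))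
    (s : SES X Y Z) (hY : StablyFinite Y) (hZ : IsSum Ω Z) : StablyFinite X := by
  obtain ⟨n, c, eZ⟩ := hZ
  obtain ⟨R, hR, ⟨t⟩⟩ := exists_ses_finSum hΩ n c
  let s' := SES.ofSurjective (Projective.π Z)
    ((ModuleCat.epi_iff_surjective _).1 inferInstance)
  have hK := (s'.nonempty_iso_iff hinj t inferInstance hR).2 eZ
  obtain ⟨E, ⟨s₁⟩, ⟨s₂⟩⟩ := s.exists_pullback s'
  have hE : StablyFinite E :=
    StablyFinite.of_ses hinj s₂ ((stablyFinite_finSum hfin n _).of_iso hK) hY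
  exact hE.of_iso (s₁.nonempty_iso_of_right inferInstance)

variable (Ω) in
/-- The inclusion of a summand. -/
def finSumInc (n : ℕ) (c : Fin n → ℤ) (j : Fin n) : Ω (c j) ⟶ finSum Ω n c :=
  ModuleCat.ofHom (LinearMap.single A (fun j => Ω (c j)) j)

variable (Ω) in
/-- The projection to a summand. -/
def finSumProj (n : ℕ) (c : Fin n → ℤ) (j : Fin n) : finSum Ω n c ⟶ Ω (c j) :=
  ModuleCat.ofHom (LinearMap.proj j)

lemma finSumInc_proj (n : ℕ) (c : Fin n → ℤ) (j : Fin n) :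
    (stab A).map (finSumInc Ω n c j) ≫ (stab A).map (finSumProj Ω n c j) = 𝟙 _ := by
  rw [← Functor.map_comp, ← (stab A).map_id]
  congr 1
  refine ModuleCat.hom_ext (LinearMap.ext fun x => ?_)
  exact Pi.single_eq_same (M := fun j => Ω (c j)) j x

lemma finSumInc_proj_of_ne (n : ℕ) (c : Fin n → ℤ) (j l : Fin n) (h : j ≠ l) :
    (stab A).map (finSumInc Ω n c j) ≫ (stab A).map (finSumProj Ω n c l) = 0 := by
  rw [← Functor.map_comp, ← (stab A).map_zero]
  congr 1
  refine ModuleCat.hom_ext (LinearMap.ext fun x => ?_)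
  exact Pi.single_eq_of_ne (M := fun j => Ω (c j)) h.symm x

lemma sum_finSumProj_inc (n : ℕ) (c : Fin n → ℤ) :
    ∑ j, (stab A).map (finSumProj Ω n c j) ≫ (stab A).map (finSumInc Ω n c j) = 𝟙 _ := by
  simp only [← Functor.map_comp, ← Functor.map_sum, ← (stab A).map_id]
  congr 1
  refine ModuleCat.hom_ext (LinearMap.ext fun x => ?_)
  rw [ModuleCat.hom_sum, LinearMap.sum_apply]
  exact Finset.univ_sum_single x

/-- Krull-Schmidt: stable retracts of finite direct sums of the modules `Ω i` are of the same
form. -/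
lemma IsSum.of_retract (hloc : ∀ i, EndLocal ((stab A).obj (Ω i)))
    (h : ∃ n c, ∃ (s : (stab A).obj M ⟶ (stab A).obj (finSum Ω n c))
      (r : (stab A).obj (finSum Ω n c) ⟶ (stab A).obj M), s ≫ r = 𝟙 _) : IsSum Ω M :=
  exists_iso_of_retract (fun i => (stab A).obj (Ω i)) hloc
    (fun n c => (stab A).obj (finSum Ω n c)) (fun n c j => (stab A).map (finSumInc Ω n c j))
    (fun n c j => (stab A).map (finSumProj Ω n c j)) sum_finSumProj_inc finSumInc_proj
    finSumInc_proj_of_ne _ h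

/-- If the identity is a sum of maps which factor through members of `Ω`, then the module is a
retract of a finite direct sum. -/
lemma exists_retract_of_list (l : List (Σ i : ℤ, ((stab A).obj M ⟶ (stab A).obj (Ω i)) ×
      ((stab A).obj (Ω i) ⟶ (stab A).obj M)))
    (hl : (l.map fun t => t.2.1 ≫ t.2.2).sum = 𝟙 _) :
    ∃ n c, ∃ (s : (stab A).obj M ⟶ (stab A).obj (finSum Ω n c))
      (r : (stab A).obj (finSum Ω n c) ⟶ (stab A).obj M), s ≫ r = 𝟙 _ := by
  let c : Fin l.length → ℤ := fun j => l[j].1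
  refine ⟨l.length, c, ∑ j, l[j].2.1 ≫ (stab A).map (finSumInc Ω _ c j),
    ∑ j, (stab A).map (finSumProj Ω _ c j) ≫ l[j].2.2, ?_⟩
  rw [← hl, ← Fin.sum_univ_fun_getElem, sum_comp]
  refine Finset.sum_congr rfl fun j _ => ?_
  rw [comp_sum, Finset.sum_eq_single j]
  · have := finSumInc_proj (Ω := Ω) _ c j
    rw [Category.assoc, reassoc_of% this]
    rfl
  · intro b _ hb
    have := finSumInc_proj_of_ne (Ω := Ω) _ c j b hb.symm
    rw [Category.assoc, reassoc_of% this, zero_comp, comp_zero]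
  · simp

end Sums

section Faithful

open Preadditive Limits

variable {k : Type} [Field k] [Algebra k A] [FiniteDimensional k A]
  {L M N : ModuleCat.{v} A} {Ω : ℤ → ModuleCat.{v} A}

/-- Fitting's lemma. -/
lemma Indecomp.endLocal [IsNoetherianRing A] [IsArtinianRing A] [Module.Finite A L]
    (h : Indecomp L) : EndLocal L := by
  intro a
  have hiso : ∀ b : Module.End A L, IsUnit b → IsIso (ModuleCat.ofHom b) := fun b hb =>
    (ConcreteCategory.isIso_iff_bijective _).2 ((Module.End.isUnit_iff b).1 hb)
  obtain ⟨n, hn, hn₀⟩ := ((LinearMap.eventually_isCompl_ker_pow_range_pow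
    (a.hom : Module.End A L)).and (Filter.eventually_ne_atTop 0)).exists
  rcases h.2 (ModuleCat.ofHom (Submodule.projection _ _ hn)) (ModuleCat.hom_ext
    (Submodule.isIdempotentElem_projection hn)) with h0 | h1
  · left
    have hker : LinearMap.ker ((a.hom : Module.End A L) ^ n) = ⊥ := by
      rw [← Submodule.range_projection hn, LinearMap.range_eq_bot]
      exact congr_arg ModuleCat.Hom.hom h0
    have hr : LinearMap.range ((a.hom : Module.End A L) ^ n) = ⊤ := by
      simpa [hker] using hn.sup_eq_top
    refine hiso a.hom ((isUnit_pow_iff hn₀).1 ((Module.End.isUnit_iff _).2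
      ⟨LinearMap.ker_eq_bot.1 hker, LinearMap.range_eq_top.1 hr⟩))
  · right
    have hker : LinearMap.ker ((a.hom : Module.End A L) ^ n) = ⊤ := by
      rw [← Submodule.range_projection hn, LinearMap.range_eq_top]
      intro x
      exact ⟨x, LinearMap.congr_fun (congr_arg ModuleCat.Hom.hom h1) x⟩
    have hnil : IsNilpotent (a.hom : Module.End A L) := ⟨n, LinearMap.ker_eq_top.1 hker⟩
    exact hiso _ hnil.isUnit_one_sub

lemma EndLocal.stab (h : EndLocal L) : EndLocal ((stab A).obj L) := by
  intro a
  obtain ⟨a, rfl⟩ := (StmodGH.stab A).map_surjective a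
  rw [← (StmodGH.stab A).map_id, ← Functor.map_sub]
  rcases h a with h | h
  · exact Or.inl inferInstance
  · exact Or.inr inferInstance

lemma endLocal_family (hinj : ∀ P : ModuleCat.{v} A, Projective P → Injective P)
    (hΩ : ∀ i : ℤ, ∃ P, Projective P ∧ Nonempty (SES (Ω (i + 1)) P (Ω i)))
    (h : EndLocal ((stab A).obj (Ω 0))) (i : ℤ) : EndLocal ((stab A).obj (Ω i)) := by
  induction i using Int.induction_on with
  | zero => exact h
  | succ i ih =>
    obtain ⟨P, hP, ⟨s⟩⟩ := hΩ i
    exact (s.endLocal_iff hinj hP).2 ih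
  | pred i ih =>
    obtain ⟨P, hP, ⟨s⟩⟩ := hΩ (-i - 1)
    rw [sub_add_cancel] at s
    exact (s.endLocal_iff hinj hP).1 ih

/-- Maps factoring through a projective module in the lowest universe are stably zero. -/
lemma stablyZero_of_factors {F : Type} [AddCommGroup F] [Module A F] [Module.Projective A F]
    (h : M →ₗ[A] F) (g : F →ₗ[A] N) : StablyZero (ModuleCat.ofHom (g ∘ₗ h)) :=
  ⟨ModuleCat.of A (ULift.{v} F), inferInstance,
    ModuleCat.ofHom (ULift.moduleEquiv.symm.toLinearMap ∘ₗ h),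
    ModuleCat.ofHom (g ∘ₗ ULift.moduleEquiv.toLinearMap), rfl⟩

variable (Ω M) in
/-- The endomorphisms of `M` which are stably sums of maps factoring through members of `Ω`. -/
def sumIdeal [Module k M] [IsScalarTower k A M] : Submodule k (M →ₗ[A] M) where
  carrier := {e | ∃ l : List (Σ i : ℤ, ((stab A).obj M ⟶ (stab A).obj (Ω i)) ×
    ((stab A).obj (Ω i) ⟶ (stab A).obj M)),
      (l.map fun t => t.2.1 ≫ t.2.2).sum = (stab A).map (ModuleCat.ofHom e)}
  zero_mem' := ⟨[], ((stab A).map_zero _ _).symm⟩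
  add_mem' := by
    rintro e e' ⟨l, hl⟩ ⟨l', hl'⟩
    refine ⟨l ++ l', ?_⟩
    rw [List.map_append, List.sum_append, hl, hl', ← Functor.map_add]
    rfl
  smul_mem' := by
    rintro a e ⟨l, hl⟩
    let u := (stab A).map (ModuleCat.ofHom (a • LinearMap.id : M →ₗ[A] M))
    refine ⟨l.map fun t => ⟨t.1, u ≫ t.2.1, t.2.2⟩, ?_⟩
    have h1 : ModuleCat.ofHom (a • e) = ModuleCat.ofHom (a • LinearMap.id : M →ₗ[A] M) ≫
        ModuleCat.ofHom e := by
      refine ModuleCat.hom_ext (LinearMap.ext fun x => ?_)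
      exact (LinearMap.map_smul_of_tower e a x).symm
    rw [h1, Functor.map_comp, ← hl, List.map_map]
    have h2 := map_list_sum (Preadditive.leftComp ((stab A).obj M) u)
      (l.map fun t => t.2.1 ≫ t.2.2)
    rw [List.map_map] at h2
    refine Eq.trans ?_ h2.symm
    congr 2
    funext t
    exact Category.assoc _ _ _

/-- If the functor represented by the modules `Ω i` is faithful, then finitely generated modules
in the thick subcategory are retracts of finite sums. -/
lemma exists_retract_of_faithful (hsym : IsSymmetricAlgebra k A)
    (hGH : ∀ M N : ModuleCat.{v} A, InThick L M → InThick L N →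
        ∀ f : M ⟶ N, (∀ (i : ℤ) (g : Ω i ⟶ M), StablyZero (g ≫ f)) → StablyZero f)
    [Module.Finite A M] (hM : InThick L M) :
    ∃ n c, ∃ (s : (stab A).obj M ⟶ (stab A).obj (finSum Ω n c))
      (r : (stab A).obj (finSum Ω n c) ⟶ (stab A).obj M), s ≫ r = 𝟙 _ := by
  let : Module k M := Module.restrictScalars k A M
  have : IsScalarTower k A M := IsScalarTower.restrictScalars k A M
  by_cases h1 : LinearMap.id ∈ sumIdeal (k := k) M Ω
  · obtain ⟨l, hl⟩ := h1
    exact exists_retract_of_list l (hl.trans ((stab A).map_id _))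
  exfalso
  obtain ⟨φ, hφ₁, hφ⟩ := Submodule.exists_le_ker_of_notMem h1
  obtain ⟨n, m, p, q, b, hp, hq, hpb, hb, hX⟩ := exists_dual_map hsym M φ
    (fun h => hφ₁ (by rw [h, LinearMap.zero_apply])) fun c y => hφ ⟨[], by
      rw [List.map_nil, List.sum_nil, eq_comm, stab_map_eq_zero_iff]
      exact stablyZero_of_factors _ _⟩
  let K : ModuleCat.{v} A := ModuleCat.of A (ULift.{v} (LinearMap.ker p))
  let F : ModuleCat.{v} A := ModuleCat.of A (ULift.{v} (Fin n → A))
  let s : SES K F M :=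
    { i := ModuleCat.ofHom (ULift.moduleEquiv.symm.toLinearMap ∘ₗ (LinearMap.ker p).subtype ∘ₗ
        ULift.moduleEquiv.toLinearMap)
      p := ModuleCat.ofHom (p ∘ₗ ULift.moduleEquiv.toLinearMap)
      inj := fun x y h => ULift.down_injective (Subtype.ext (congr_arg ULift.down h))
      surj := hp.comp ULift.down_surjective
      exact := fun y => ⟨fun h => ⟨⟨y.down, h⟩, rfl⟩, by rintro ⟨x, rfl⟩; exact x.down.2⟩ }
  have hK : InThick L K := .ext₃ s (.proj F inferInstance) hM
  let ω : M ⟶ K := ModuleCat.ofHom (ULift.moduleEquiv.symm.toLinearMap ∘ₗ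
    b.codRestrict (LinearMap.ker p) fun x => LinearMap.congr_fun hpb x)
  let q' : (Fin m → A) →ₗ[A] K := ULift.moduleEquiv.symm.toLinearMap ∘ₗ
    q.codRestrict (LinearMap.ker p) fun x => hq ▸ LinearMap.mem_range_self q x
  have hq' : Function.Surjective q' := by
    rintro ⟨y, hy⟩
    rw [← hq] at hy
    obtain ⟨x, rfl⟩ := hy
    exact ⟨x, rfl⟩
  obtain ⟨P, hP, u, w, huw⟩ := hGH M K hM hK ω fun i g => by
    obtain ⟨e, he⟩ := hX (Ω i) g.hom fun h => hφ
      ⟨[⟨i, (stab A).map (ModuleCat.ofHom h), (stab A).map g⟩], by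
        rw [List.map_singleton, List.sum_singleton, ← Functor.map_comp]
        rfl⟩
    have : g ≫ ω = ModuleCat.ofHom (q' ∘ₗ e) := by
      refine ModuleCat.hom_ext (LinearMap.ext fun x => ?_)
      exact ULift.down_injective (Subtype.ext (LinearMap.congr_fun he x))
    rw [this]
    exact stablyZero_of_factors _ _
  have : Module.Projective A P := inferInstance
  obtain ⟨w', hw'⟩ := Module.projective_lifting_property q' w.hom hq'
  refine hb ⟨w' ∘ₗ u.hom, LinearMap.ext fun x => ?_⟩
  have h2 : ω x = w (u x) := ConcreteCategory.congr_hom huw x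
  have h3 : q' (w' (u x)) = w (u x) := LinearMap.congr_fun hw' (u x)
  exact congr_arg (fun z : K => z.down.1) (h2.trans h3.symm)

lemma isSum_of_inThick (hsym : IsSymmetricAlgebra k A) [Module.Finite A L] (hL : Indecomp L)
    (hΩ : IsSyzygyFamily L Ω)
    (hGH : ∀ M N : ModuleCat.{v} A, InThick L M → InThick L N →
        ∀ f : M ⟶ N, (∀ (i : ℤ) (g : Ω i ⟶ M), StablyZero (g ≫ f)) → StablyZero f)
    (hM : InThick L M) : IsSum Ω M := by
  obtain ⟨hfin, h0, hses⟩ := hΩ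
  have hinj := injective_of_projective.{v} hsym
  have : IsNoetherianRing A := isNoetherian_of_tower k inferInstance
  have : IsArtinianRing A := isArtinian_of_tower k inferInstance
  obtain ⟨e₀⟩ := stablyIso_iff.1 h0
  have hloc := endLocal_family hinj hses ((hL.endLocal).stab.of_iso e₀.symm)
  have key : ∀ {M : ModuleCat.{v} A}, InThick L M → StablyFinite M → IsSum Ω M := by
    rintro M hM ⟨M', _, e⟩
    exact (IsSum.of_retract hloc (exists_retract_of_faithful hsym hGH
      (.iso (stablyIso_iff.2 e) hM))).of_iso e
  induction hM with
  | gen => exact key .gen ⟨L, inferInstance, ⟨Iso.refl _⟩⟩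
  | proj P hP =>
    refine IsSum.of_retract hloc ⟨0, Fin.elim0, 0, 0, ?_⟩
    rw [comp_zero, ← (stab A).map_id, eq_comm, stab_map_eq_zero_iff]
    exact ⟨P, hP, 𝟙 P, 𝟙 P, by simp⟩
  | iso e _ ih => exact ih.of_iso ((stablyIso_iff.1 e).map Iso.symm)
  | ext₁ s hX hY ihX ihY =>
    exact key (.ext₁ s hX hY) (s.stablyFinite_right hinj hfin hses ihX (ihY.stablyFinite hfin))
  | ext₂ s hX hZ ihX ihZ =>
    exact key (.ext₂ s hX hZ) (.of_ses hinj s (ihX.stablyFinite hfin) (ihZ.stablyFinite hfin))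
  | ext₃ s hY hZ ihY ihZ =>
    exact key (.ext₃ s hY hZ) (s.stablyFinite_left hinj hfin hses (ihY.stablyFinite hfin) ihZ)
  | summand h _ ih =>
    obtain ⟨s, r, hsr⟩ := h
    obtain ⟨n, c, ⟨e⟩⟩ := ih
    refine IsSum.of_retract hloc ⟨n, c, (stab A).map s ≫ e.hom, e.inv ≫ (stab A).map r, ?_⟩
    rw [Category.assoc, e.hom_inv_id_assoc, ← Functor.map_comp, hsr, (stab A).map_id]

/-- The modules `Ω i` detect maps out of their finite direct sums. -/
lemma IsSum.stablyZero (hM : IsSum Ω M) (f : M ⟶ N)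
    (hf : ∀ (i : ℤ) (g : Ω i ⟶ M), StablyZero (g ≫ f)) : StablyZero f := by
  obtain ⟨n, c, ⟨e⟩⟩ := hM
  rw [← stab_map_eq_zero_iff, ← cancel_epi e.inv, comp_zero,
    ← Category.id_comp (e.inv ≫ _), ← sum_finSumProj_inc, sum_comp]
  refine Finset.sum_eq_zero fun j _ => ?_
  obtain ⟨g, hg⟩ := (stab A).map_surjective ((stab A).map (finSumInc Ω n c j) ≫ e.inv)
  have h := hf _ g
  rw [← stab_map_eq_zero_iff, Functor.map_comp, hg, Category.assoc] at h
  rw [Category.assoc, h, comp_zero]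

end Faithful

/-- Let `A` be a finite dimensional symmetric `k`-algebra and `L` a
finitely generated non-projective indecomposable `A`-module. The functor
`Hom_stmod(Ω^* L, −)` is faithful on `thick(L)` if and only if every object of `thick(L)`
is stably isomorphic to a finite direct sum of suspensions `Ω^i L`. -/
theorem symmetric_algebra_GH_iff_thick_is_sums
    (k A : Type) [Field k] [Ring A] [Algebra k A] [FiniteDimensional k A]
    (hsym : IsSymmetricAlgebra k A)
    (L : ModuleCat A) [Module.Finite A L] (hLnp : ¬ Projective L) (hLind : Indecomp L)
    (ΩL : ℤ → ModuleCat A) (hΩL : IsSyzygyFamily L ΩL) :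
    (∀ M N : ModuleCat A, InThick L M → InThick L N →
        ∀ f : M ⟶ N, (∀ (i : ℤ) (g : ΩL i ⟶ M), StablyZero (g ≫ f)) → StablyZero f) ↔
      (∀ M : ModuleCat A, InThick L M →
        ∃ (n : ℕ) (c : Fin n → ℤ),
          StablyIso M (ModuleCat.of A (∀ j : Fin n, ΩL (c j)))) := by
  constructor
  · intro hGH M hM
    obtain ⟨n, c, e⟩ := isSum_of_inThick hsym hLind hΩL hGH hM
    exact ⟨n, c, stablyIso_iff.2 e⟩
  · intro h M N hM _ f hf
    obtain ⟨n, c, e⟩ := h M hM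
    exact IsSum.stablyZero ⟨n, c, stablyIso_iff.1 e⟩ f hf

end StmodGH
end
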